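/- (Theorem 1) Let X be a Polish space and P a point process on X of first order. Then P is a Poisson point process if and only if for some q ∈ (0,1) the splitting law factorizes into its marginals: S_q(P) = Γ_q(P) ⊗ Γ_{1−q}(P). Moreover, in that case P = Π_{ν_P}. -/

import Mathlib

open MeasureTheory ENNReal

noncomputable section

namespace PoissonSplitting

variable {X : Type*} [MeasurableSpace X] [MetricSpace X]

/-- `expNeg a = e^{-a}` for an extended nonnegative real `a`. -/
def expNeg (a : ℝ≥0∞) : ℝ≥0∞ := if a = ∞ then 0 else ENNReal.ofReal (Real.exp (-a.toReal))

/-- A (Radon) point measure on `X`: a locally finite countable sum of Dirac measures. -/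
def IsPointMeasure (μ : Measure X) : Prop :=
  (∃ D : ℕ → Option X, μ = Measure.sum fun n => (D n).elim 0 Measure.dirac) ∧
    IsLocallyFiniteMeasure μ

/-- The class `U` of nonnegative bounded measurable functions on `X` whose support is
contained in some bounded set. -/
def MemU (f : X → ℝ) : Prop :=
  Measurable f ∧ (∀ x, 0 ≤ f x) ∧ (∃ C, ∀ x, f x ≤ C) ∧
    Bornology.IsBounded (Function.support f)

/-- The pairing `ζ_f(ν) = ν(f)`, as an extended nonnegative real. -/
def pairing (f : X → ℝ) (ν : Measure X) : ℝ≥0∞ := ∫⁻ x, ENNReal.ofReal (f x) ∂ν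

/-- The Laplace transform of a law `P` on measures: `L_P(f) = ∫ e^{-ν(f)} P(dν)`. -/
def laplaceT (P : Measure (Measure X)) (f : X → ℝ) : ℝ≥0∞ := ∫⁻ ν, expNeg (pairing f ν) ∂P

/-- `T` is the independent `q`-thinning `T^μ_q` of the point measure `μ`:
the probability law, supported on point-measure subconfigurations of `μ`, whose Laplace
transform on test functions `f ∈ U` is
`T(e^{-ζ_f}) = ∏_{x∈μ}(1-q+q e^{-f(x)})^{μ({x})} = exp(∫ log(1-q+q e^{-f}) dμ)`. -/
def IsThinning (q : ℝ) (μ : Measure X) (T : Measure (Measure X)) : Prop :=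
  IsProbabilityMeasure T ∧ (∀ᵐ ν ∂T, IsPointMeasure ν ∧ ν ≤ μ) ∧
    ∀ f : X → ℝ, MemU f →
      laplaceT T f =
        expNeg (∫⁻ x, ENNReal.ofReal (-Real.log (1 - q + q * Real.exp (-f x))) ∂μ)

/-- `P` is the Poisson point process `Π_ϱ` with intensity (first moment) measure `ϱ`:
the point process with Laplace transform `L_P(f) = exp(-ϱ(1 - e^{-f}))`, `f ∈ U`. -/
def IsPoissonPP (ϱ : Measure X) (P : Measure (Measure X)) : Prop :=
  IsProbabilityMeasure P ∧ (∀ᵐ μ ∂P, IsPointMeasure μ) ∧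
    ∀ f : X → ℝ, MemU f →
      laplaceT P f = expNeg (∫⁻ x, ENNReal.ofReal (1 - Real.exp (-f x)) ∂ϱ)

/-- A point process: a probability law on the point measures of `X`. -/
def IsPointProcess (P : Measure (Measure X)) : Prop :=
  IsProbabilityMeasure P ∧ ∀ᵐ μ ∂P, IsPointMeasure μ

/-- The first moment (intensity) measure `ν_P` of a point process `P`:
`ν_P(B) = ∫ μ(B) P(dμ)`. -/
def momentMeasure (P : Measure (Measure X)) : Measure X := P.bind id

/-- `P` is of first order if its first moment measure is a Radon (locally finite) measure. -/
def IsFirstOrder (P : Measure (Measure X)) : Prop := IsLocallyFiniteMeasure (momentMeasure P)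

end PoissonSplitting

set_option linter.unusedSectionVars false

namespace PoissonSplitting

lemma expNeg_eq_exp (a : ℝ≥0∞) : expNeg a = EReal.exp (-(a : EReal)) := by
  unfold expNeg
  split_ifs with h
  · subst h; simp
  · lift a to NNReal using h
    simp only [ENNReal.coe_toReal]
    have : (-(((a : ℝ≥0∞)) : EReal)) = ((-(a : ℝ) : ℝ) : EReal) := by
      rw [EReal.coe_neg]; rfl
    rw [this, EReal.exp_coe]

lemma expNeg_zero : expNeg 0 = 1 := by simp [expNeg]
lemma expNeg_top : expNeg ∞ = 0 := by simp [expNeg]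

lemma expNeg_ofReal {a : ℝ} (ha : 0 ≤ a) :
    expNeg (ENNReal.ofReal a) = ENNReal.ofReal (Real.exp (-a)) := by
  simp [expNeg, ha]

lemma expNeg_antitone : Antitone expNeg := by
  intro a b h
  rw [expNeg_eq_exp, expNeg_eq_exp]
  apply EReal.exp_monotone
  simpa using h

lemma expNeg_le_one (a : ℝ≥0∞) : expNeg a ≤ 1 := by
  rw [← expNeg_zero]; exact expNeg_antitone bot_le

lemma expNeg_add (a b : ℝ≥0∞) : expNeg (a + b) = expNeg a * expNeg b := by
  by_cases ha : a = ∞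
  · simp [ha, expNeg_top]
  by_cases hb : b = ∞
  · simp [hb, expNeg_top]
  simp only [expNeg, ha, hb, ENNReal.add_eq_top, or_self, if_false]
  rw [ENNReal.toReal_add ha hb, ← ENNReal.ofReal_mul (Real.exp_pos _).le, ← Real.exp_add]
  congr 2; ring

lemma expNeg_continuous : Continuous expNeg := by
  have : expNeg = fun a : ℝ≥0∞ => EReal.exp (-(a : EReal)) := funext expNeg_eq_exp
  rw [this]
  exact ENNReal.continuous_exp.comp (continuous_neg.comp continuous_coe_ennreal_ereal)

@[fun_prop]
lemma expNeg_measurable : Measurable expNeg := expNeg_continuous.measurable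

/-- left inverse of `expNeg` -/
def logNeg (y : ℝ≥0∞) : ℝ≥0∞ := if y = 0 then ∞ else ENNReal.ofReal (-Real.log y.toReal)

lemma logNeg_expNeg (a : ℝ≥0∞) : logNeg (expNeg a) = a := by
  unfold logNeg expNeg
  by_cases ha : a = ∞
  · simp [ha]
  · simp [ha, (Real.exp_pos _).le, Real.exp_pos]

lemma logNeg_measurable : Measurable logNeg := by
  unfold logNeg
  refine Measurable.ite (measurableSet_singleton 0) measurable_const ?_
  fun_prop

lemma expNeg_prod_sum {ι : Type*} (s : Finset ι) (a : ι → ℝ≥0∞) :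
    expNeg (∑ i ∈ s, a i) = ∏ i ∈ s, expNeg (a i) := by
  classical
  induction s using Finset.induction_on with
  | empty => simp [expNeg_zero]
  | insert i s hi ih => rw [Finset.sum_insert hi, Finset.prod_insert hi, expNeg_add, ih]

lemma tendsto_expNeg_tsum (a : ℕ → ℝ≥0∞) :
    Filter.Tendsto (fun n => ∏ i ∈ Finset.range n, expNeg (a i)) Filter.atTop
      (nhds (expNeg (∑' i, a i))) := by
  simp_rw [← expNeg_prod_sum]
  exact (expNeg_continuous.tendsto _).comp (ENNReal.tendsto_nat_tsum a)

open scoped BoundedContinuousFunction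

/-- Multiplicative systems determine finite measures. -/
lemma unique_fin {Ω ι : Type*} [MeasurableSpace Ω] (φ : ι → Ω → ℝ)
    (hm : ∀ i, Measurable (φ i)) (h0 : ∀ i ω, 0 ≤ φ i ω) (h1 : ∀ i ω, φ i ω ≤ 1)
    (hmul : ∀ i j, ∃ k, φ k = φ i * φ j) (hone : ∃ k, φ k = 1)
    (μ ν : Measure Ω) [IsFiniteMeasure μ] [IsFiniteMeasure ν]
    (h : ∀ i, ∫ ω, φ i ω ∂μ = ∫ ω, φ i ω ∂ν) (J : Finset ι) :
    μ.map (fun ω (j : J) => φ j ω) = ν.map (fun ω (j : J) => φ j ω) := by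
  classical
  let E := J → Set.Icc (0:ℝ) 1
  let Ψ : Ω → E := fun ω j => ⟨φ j ω, h0 _ _, h1 _ _⟩
  have hΨ : Measurable Ψ := by
    refine measurable_pi_lambda _ fun j => ?_
    exact (hm j).subtype_mk
  let c : J → (E →ᵇ ℝ) := fun j => BoundedContinuousFunction.mkOfCompact
    ⟨fun e => (e j : ℝ), by fun_prop⟩
  have hstar : ∀ f : E →ᵇ ℝ, star f = f := by
    intro f; ext x; simp
  let A : StarSubalgebra ℝ (E →ᵇ ℝ) :=
    { Algebra.adjoin ℝ (Set.range c) with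
      star_mem' := by
        intro a ha
        rw [hstar]; exact ha }
  have key : μ.map Ψ = ν.map Ψ := by
    refine ext_of_forall_mem_subalgebra_integral_eq_of_polish (𝕜 := ℝ) (A := A) ?_ ?_
    · intro x y hxy
      obtain ⟨j, hj⟩ := Function.ne_iff.1 hxy
      refine ⟨fun e => (e j : ℝ), ⟨BoundedContinuousFunction.toContinuousMapStarₐ ℝ (c j), ?_, rfl⟩, ?_⟩
      · refine ⟨c j, ?_, rfl⟩
        exact Algebra.subset_adjoin ⟨j, rfl⟩
      · simpa [Subtype.ext_iff] using hj
    · intro g hg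
      have hg' : g ∈ Submodule.span ℝ (Submonoid.closure (Set.range c) : Set (E →ᵇ ℝ)) := by
        have : g ∈ Subalgebra.toSubmodule (Algebra.adjoin ℝ (Set.range c)) := hg
        rwa [Algebra.adjoin_eq_span] at this
      have adj : ∀ g ∈ Submodule.span ℝ (Submonoid.closure (Set.range c) : Set (E →ᵇ ℝ)),
          g ∈ A := by
        intro g hg
        rw [← Algebra.adjoin_eq_span] at hg
        exact hg
      have mono : ∀ m ∈ Submonoid.closure (Set.range c), ∃ k, ∀ ω, m (Ψ ω) = φ k ω := by
        intro m hm'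
        induction hm' using Submonoid.closure_induction with
        | mem x hx =>
          obtain ⟨j, rfl⟩ := hx
          exact ⟨j, fun ω => rfl⟩
        | one => obtain ⟨k, hk⟩ := hone; exact ⟨k, fun ω => by simp [hk]⟩
        | mul x y _ _ hx hy =>
          obtain ⟨i, hi⟩ := hx
          obtain ⟨j, hj⟩ := hy
          obtain ⟨k, hk⟩ := hmul i j
          exact ⟨k, fun ω => by simp [hk, hi, hj]⟩
      have hinteg : ∀ (f : E →ᵇ ℝ) (ρ : Measure Ω) [IsFiniteMeasure ρ],
          Integrable (fun x => f x) (ρ.map Ψ) := fun f ρ _ => f.integrable _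
      induction hg' using Submodule.span_induction with
      | mem x hx =>
        obtain ⟨k, hk⟩ := mono x hx
        rw [integral_map hΨ.aemeasurable x.continuous.aestronglyMeasurable,
          integral_map hΨ.aemeasurable x.continuous.aestronglyMeasurable]
        simp_rw [hk]; exact h k
      | zero => simp
      | add x y hx' hy' hx hy =>
        have e1 := hx (adj x hx')
        have e2 := hy (adj y hy')
        simp only [BoundedContinuousFunction.coe_add, Pi.add_apply]
        rw [integral_add (hinteg x μ) (hinteg y μ), integral_add (hinteg x ν) (hinteg y ν), e1, e2]
      | smul a x hx' hx =>
        have e1 := hx (adj x hx')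
        simp only [BoundedContinuousFunction.coe_smul, smul_eq_mul, integral_const_mul]
        rw [e1]
  have hval : Measurable (fun (e : E) (j : J) => (e j : ℝ)) := by fun_prop
  have := congrArg (fun ρ => ρ.map (fun (e : E) (j : J) => (e j : ℝ))) key
  simp only [Measure.map_map hval hΨ] at this
  exact this


lemma unique_gen {Ω ι : Type*} [mΩ : MeasurableSpace Ω] (φ : ι → Ω → ℝ≥0∞)
    (hm : ∀ i, Measurable (φ i)) (h1 : ∀ i ω, φ i ω ≤ 1)
    (hmul : ∀ i j, ∃ k, φ k = φ i * φ j) (hone : ∃ k, φ k = 1)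
    (hgen : mΩ ≤ ⨆ i, MeasurableSpace.comap (φ i) inferInstance)
    (μ ν : Measure Ω) [IsFiniteMeasure μ] [IsFiniteMeasure ν]
    (h : ∀ i, ∫⁻ ω, φ i ω ∂μ = ∫⁻ ω, φ i ω ∂ν) : μ = ν := by
  classical
  let ψ : ι → Ω → ℝ := fun i ω => (φ i ω).toReal
  have hψm : ∀ i, Measurable (ψ i) := fun i => (hm i).ennreal_toReal
  have hfin : ∀ i ω, φ i ω ≠ ∞ := fun i ω => ne_top_of_le_ne_top one_ne_top (h1 i ω)
  have hJ := unique_fin ψ hψm (fun i ω => toReal_nonneg)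
    (fun i ω => by
      have := ENNReal.toReal_mono one_ne_top (h1 i ω)
      simpa using this)
    (fun i j => by
      obtain ⟨k, hk⟩ := hmul i j
      exact ⟨k, by funext ω; simp [ψ, hk]⟩)
    (by obtain ⟨k, hk⟩ := hone; exact ⟨k, by funext ω; simp [ψ, hk]⟩)
    μ ν
    (fun i => by
      simp only [ψ]
      rw [integral_toReal (hm i).aemeasurable (ae_of_all _ fun ω => (hfin i ω).lt_top),
        integral_toReal (hm i).aemeasurable (ae_of_all _ fun ω => (hfin i ω).lt_top), h i])
  let Φ : Ω → ι → ℝ := fun ω i => ψ i ω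
  have hΦ : Measurable Φ := measurable_pi_lambda _ hψm
  have hmap : μ.map Φ = ν.map Φ := by
    let Pr : (J : Finset ι) → Measure (J → ℝ) := fun J => μ.map (fun ω (j : J) => ψ j ω)
    have : ∀ J, IsFiniteMeasure (Pr J) := fun J => Measure.isFiniteMeasure_map _ _
    refine IsProjectiveLimit.unique (P := Pr) ?_ ?_
    · intro J
      rw [Measure.map_map (Finset.measurable_restrict J) hΦ]; rfl
    · intro J
      rw [Measure.map_map (Finset.measurable_restrict J) hΦ]
      exact (hJ J).symm
  ext s hs
  have hs' : MeasurableSet[MeasurableSpace.comap Φ inferInstance] s := by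
    refine (hgen.trans ?_) s hs
    refine iSup_le fun i => ?_
    rw [← measurable_iff_comap_le]
    have : φ i = fun ω => ENNReal.ofReal (Φ ω i) := by
      funext ω; simp [Φ, ψ, hfin]
    rw [this]
    have hc : @Measurable _ _ (MeasurableSpace.comap Φ inferInstance) _ Φ := comap_measurable Φ
    have hc2 : @Measurable _ _ (MeasurableSpace.comap Φ inferInstance) _ (fun ω => Φ ω i) :=
      (measurable_pi_apply i).comp hc
    exact ENNReal.measurable_ofReal.comp hc2
  obtain ⟨t, ht, rfl⟩ := hs'
  rw [← Measure.map_apply hΦ ht, ← Measure.map_apply hΦ ht, hmap]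

variable {X : Type*} [MeasurableSpace X] [MetricSpace X]

lemma MemU.add {f g : X → ℝ} (hf : MemU f) (hg : MemU g) : MemU (f + g) := by
  obtain ⟨a, b, ⟨C, c⟩, d⟩ := hf
  obtain ⟨a', b', ⟨C', c'⟩, d'⟩ := hg
  refine ⟨a.add a', fun x => add_nonneg (b x) (b' x), ⟨C + C', fun x => add_le_add (c x) (c' x)⟩, ?_⟩
  exact (d.union d').subset (Function.support_add f g)

lemma MemU.zero : MemU (0 : X → ℝ) :=
  ⟨measurable_zero, fun _ => le_rfl, ⟨0, fun _ => le_rfl⟩, by simp⟩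

lemma pairing_add {f g : X → ℝ} (hf : MemU f) (hg : MemU g) (ν : Measure X) :
    pairing (f + g) ν = pairing f ν + pairing g ν := by
  unfold pairing
  rw [← lintegral_add_left hf.1.ennreal_ofReal]
  refine lintegral_congr fun x => ?_
  exact ENNReal.ofReal_add (hf.2.1 x) (hg.2.1 x)

lemma pairing_zero (ν : Measure X) : pairing (0 : X → ℝ) ν = 0 := by simp [pairing]

lemma pairing_measurable {f : X → ℝ} (hf : MemU f) : Measurable (pairing f) :=
  Measure.measurable_lintegral hf.1.ennreal_ofReal

lemma gen_one [OpensMeasurableSpace X] : (Measure.instMeasurableSpace : MeasurableSpace (Measure X)) ≤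
    ⨆ f : {f : X → ℝ // MemU f}, MeasurableSpace.comap (fun ν => expNeg (pairing f.1 ν)) inferInstance := by
  set m' := ⨆ f : {f : X → ℝ // MemU f},
    MeasurableSpace.comap (fun ν : Measure X => expNeg (pairing f.1 ν)) inferInstance with hm'
  have hmeas : ∀ f : X → ℝ, MemU f → Measurable[m'] (fun ν => pairing f ν) := by
    intro f hf
    have h1 : Measurable[m'] (fun ν : Measure X => expNeg (pairing f ν)) := by
      rw [measurable_iff_comap_le]
      exact le_iSup (fun f : {f : X → ℝ // MemU f} =>
        MeasurableSpace.comap (fun ν : Measure X => expNeg (pairing f.1 ν)) inferInstance) ⟨f, hf⟩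
    have := logNeg_measurable.comp h1
    simpa [Function.comp_def, logNeg_expNeg] using this
  have key : Measurable[m', Measure.instMeasurableSpace] (id : Measure X → Measure X) := by
    refine @Measure.measurable_of_measurable_coe _ _ _ m' _ fun s hs => ?_
    rcases isEmpty_or_nonempty X with hX | ⟨⟨x0⟩⟩
    · have : s = ∅ := Set.eq_empty_of_isEmpty s
      simp only [this, measure_empty]
      exact @measurable_const _ _ _ m' _
    have : (fun ν : Measure X => id ν s) =
        fun ν => ⨆ n : ℕ, pairing ((s ∩ Metric.ball x0 n).indicator 1) ν := by
      funext ν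
      have hp : ∀ n : ℕ, pairing ((s ∩ Metric.ball x0 n).indicator 1) ν = ν (s ∩ Metric.ball x0 n) := by
        intro n
        unfold pairing
        rw [← lintegral_indicator_one (hs.inter Metric.isOpen_ball.measurableSet)]
        refine lintegral_congr fun x => ?_
        by_cases hx : x ∈ s ∩ Metric.ball x0 n
        · rw [Set.indicator_of_mem hx, Set.indicator_of_mem hx]; simp
        · rw [Set.indicator_of_notMem hx, Set.indicator_of_notMem hx]; simp
      simp_rw [hp]
      rw [← Monotone.measure_iUnion]
      · rw [← Set.inter_iUnion, Metric.iUnion_ball_nat, Set.inter_univ]; rfl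
      · intro a b hab
        exact Set.inter_subset_inter_right _ (Metric.ball_subset_ball (by exact_mod_cast hab))
    rw [this]
    refine Measurable.iSup fun n => hmeas _ ⟨?_, ?_, ⟨1, ?_⟩, ?_⟩
    · exact measurable_one.indicator (hs.inter Metric.isOpen_ball.measurableSet)
    · intro x; exact Set.indicator_nonneg (fun _ _ => zero_le_one) x
    · intro x; exact Set.indicator_le_self' (fun _ _ => zero_le_one) x
    · exact Metric.isBounded_ball.subset (Set.support_indicator_subset.trans Set.inter_subset_right)
  exact fun s hs => key hs

lemma laplace_unique [OpensMeasurableSpace X] (P Q : Measure (Measure X)) [IsFiniteMeasure P]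
    [IsFiniteMeasure Q] (h : ∀ f, MemU f → laplaceT P f = laplaceT Q f) : P = Q := by
  refine unique_gen (fun (f : {f : X → ℝ // MemU f}) ν => expNeg (pairing f.1 ν)) ?_ ?_ ?_ ?_
    gen_one P Q ?_
  · exact fun f => expNeg_measurable.comp (pairing_measurable f.2)
  · exact fun f ν => expNeg_le_one _
  · intro f g
    refine ⟨⟨f.1 + g.1, f.2.add g.2⟩, ?_⟩
    funext ν
    simp [pairing_add f.2 g.2, expNeg_add]
  · exact ⟨⟨0, MemU.zero⟩, by funext ν; simp [pairing_zero, expNeg_zero]⟩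
  · exact fun f => h f.1 f.2

lemma laplace_unique_pair [OpensMeasurableSpace X] (P Q : Measure (Measure X × Measure X))
    [IsFiniteMeasure P] [IsFiniteMeasure Q]
    (h : ∀ f g, MemU f → MemU g →
      ∫⁻ p, expNeg (pairing f p.1) * expNeg (pairing g p.2) ∂P =
      ∫⁻ p, expNeg (pairing f p.1) * expNeg (pairing g p.2) ∂Q) : P = Q := by
  refine unique_gen (fun (f : {f : X → ℝ // MemU f} × {f : X → ℝ // MemU f})
    (p : Measure X × Measure X) => expNeg (pairing f.1.1 p.1) * expNeg (pairing f.2.1 p.2))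
    ?_ ?_ ?_ ?_ ?_ P Q ?_
  · exact fun f => (expNeg_measurable.comp ((pairing_measurable f.1.2).comp measurable_fst)).mul
      (expNeg_measurable.comp ((pairing_measurable f.2.2).comp measurable_snd))
  · exact fun f ν => mul_le_one' (expNeg_le_one _) (expNeg_le_one _)
  · intro f g
    refine ⟨(⟨f.1.1 + g.1.1, f.1.2.add g.1.2⟩, ⟨f.2.1 + g.2.1, f.2.2.add g.2.2⟩), ?_⟩
    funext ν
    simp only [pairing_add f.1.2 g.1.2, pairing_add f.2.2 g.2.2, expNeg_add, Pi.mul_apply]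
    ring
  · exact ⟨(⟨0, MemU.zero⟩, ⟨0, MemU.zero⟩), by funext ν; simp [pairing_zero, expNeg_zero]⟩
  · refine sup_le ?_ ?_
    · refine (MeasurableSpace.comap_mono gen_one).trans ?_
      rw [MeasurableSpace.comap_iSup]
      refine iSup_le fun f => ?_
      refine le_trans (le_of_eq ?_) (le_iSup _ (f, (⟨0, MemU.zero⟩ : {f : X → ℝ // MemU f})))
      rw [MeasurableSpace.comap_comp]
      congr 1
      funext p; simp [pairing_zero, expNeg_zero]
    · refine (MeasurableSpace.comap_mono gen_one).trans ?_
      rw [MeasurableSpace.comap_iSup]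
      refine iSup_le fun f => ?_
      refine le_trans (le_of_eq ?_) (le_iSup _ ((⟨0, MemU.zero⟩ : {f : X → ℝ // MemU f}), f))
      rw [MeasurableSpace.comap_comp]
      congr 1
      funext p; simp [pairing_zero, expNeg_zero]
  · exact fun f => h _ _ f.1.2 f.2.2

end PoissonSplitting

namespace PoissonSplitting

lemma tsum_zero_one (a : ℕ → ℝ≥0∞) (h : ∀ n, a n = 0 ∨ a n = 1) :
    (∑' n, a n) = ∞ ∨ ∃ k : ℕ, (∑' n, a n) = k := by
  have : (∑' n, a n) = (({n | a n = 1} : Set ℕ).encard : ℝ≥0∞) := by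
    rw [← ENNReal.tsum_set_one, tsum_subtype {n | a n = 1} (fun _ => (1 : ℝ≥0∞))]
    congr 1; funext n
    rcases h n with h | h <;> simp [Set.indicator, h]
  rw [this]
  rcases eq_or_ne (({n | a n = 1} : Set ℕ).encard) ⊤ with h | h
  · left; simp [h]
  · right
    obtain ⟨k, hk⟩ := ENat.ne_top_iff_exists.1 h
    exact ⟨k, by rw [← hk]; simp⟩

lemma tsum_lt_count (k : ℕ) : (∑' i : ℕ, if ((i : ℝ≥0∞) + 1) ≤ k then (1 : ℝ≥0∞) else 0) = k := by
  have : ∀ i : ℕ, (if ((i : ℝ≥0∞) + 1) ≤ k then (1 : ℝ≥0∞) else 0) = if i ∈ Finset.range k then 1 else 0 := by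
    intro i
    have : ((i : ℝ≥0∞) + 1 ≤ k) ↔ i ∈ Finset.range k := by
      rw [Finset.mem_range]
      exact_mod_cast Iff.rfl
    simp only [this]
  simp_rw [this]
  rw [tsum_eq_sum (s := Finset.range k)]
  · rw [Finset.sum_congr rfl (fun i hi => if_pos hi)]
    simp
  · intro b hb; simp only [hb, if_false]

/-- quantile of level `i+1` -/
def qt (i : ℕ) (m : Measure ℝ) : EReal :=
  ⨅ r : ℚ, if ((i : ℝ≥0∞) + 1) ≤ m (Set.Iic (r : ℝ)) then ((r : ℝ) : EReal) else ⊤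

lemma qt_measurable (i : ℕ) : Measurable (qt i) := by
  unfold qt
  refine Measurable.iInf fun r => Measurable.ite ?_ measurable_const measurable_const
  exact measurableSet_le measurable_const (Measure.measurable_coe measurableSet_Iic)

lemma qt_le_iff (i : ℕ) (m : Measure ℝ) [IsFiniteMeasure m] (t : ℝ) :
    qt i m ≤ t ↔ ((i : ℝ≥0∞) + 1) ≤ m (Set.Iic t) := by
  constructor
  · intro h
    by_contra! hlt
    have hI : Set.Iic t = ⋂ n : ℕ, Set.Iic (t + 1 / ((n : ℝ) + 1)) := by
      ext x
      simp only [Set.mem_Iic, Set.mem_iInter]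
      constructor
      · intro hx n
        have : 0 < 1 / ((n : ℝ) + 1) := by positivity
        linarith
      · intro hx
        refine le_of_forall_pos_le_add fun ε hε => ?_
        obtain ⟨n, hn⟩ := exists_nat_one_div_lt hε
        linarith [hx n]
    have ht := tendsto_measure_iInter_atTop (μ := m) (s := fun n : ℕ => Set.Iic (t + 1 / ((n : ℝ) + 1)))
      (fun n => measurableSet_Iic.nullMeasurableSet)
      (fun a b hab => Set.Iic_subset_Iic.2 (by
        have := Nat.one_div_le_one_div (α := ℝ) hab
        linarith)) ⟨0, measure_ne_top _ _⟩
    rw [← hI] at ht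
    obtain ⟨n, hn⟩ := (ht.eventually_lt_const hlt).exists
    have hpos : 0 < 1 / ((n : ℝ) + 1) := by positivity
    have : ((t + 1 / ((n : ℝ) + 1) : ℝ) : EReal) ≤ qt i m := by
      refine le_iInf fun r => ?_
      split_ifs with hr
      · by_contra! hlt'
        have h2 : (r : ℝ) < t + 1 / ((n : ℝ) + 1) := by exact_mod_cast hlt'
        exact absurd (hr.trans (measure_mono (Set.Iic_subset_Iic.2 h2.le))) (not_le.2 hn)
      · exact le_top
    have h3 := this.trans h
    have h4 : t + 1 / ((n : ℝ) + 1) ≤ t := by exact_mod_cast h3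
    linarith
  · intro h
    by_contra! hlt
    obtain ⟨r, hr1, hr2⟩ := EReal.lt_iff_exists_rat_btwn.1 hlt
    have hr1' : t < (r : ℝ) := by exact_mod_cast hr1
    have : qt i m ≤ ((r : ℝ) : EReal) := by
      refine (iInf_le _ r).trans ?_
      rw [if_pos (h.trans (measure_mono (Set.Iic_subset_Iic.2 hr1'.le)))]
    exact absurd hr2 (not_lt.2 this)

/-- the enumerated points of a finite point measure on the line. -/
def qd (i : ℕ) (m : Measure ℝ) : Measure ℝ :=
  if ((i : ℝ≥0∞) + 1) ≤ m Set.univ then Measure.dirac (qt i m).toReal else 0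

lemma qd_sum (m : Measure ℝ) [IsFiniteMeasure m] (h : ∀ t, ∃ k : ℕ, m (Set.Iic t) = k) :
    m = Measure.sum (fun i => qd i m) := by
  refine Measure.ext_of_Iic _ _ fun t => ?_
  rw [Measure.sum_apply _ measurableSet_Iic]
  obtain ⟨k, hk⟩ := h t
  have : ∀ i, qd i m (Set.Iic t) = if ((i : ℝ≥0∞) + 1) ≤ k then (1 : ℝ≥0∞) else 0 := by
    intro i
    unfold qd
    split_ifs with h1 h2 h2
    · have h3 : qt i m ≤ t := (qt_le_iff i m t).2 (hk ▸ h2)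
      have hbot : qt i m ≠ ⊥ := by
        intro hb
        have hb2 : ∀ s : ℝ, 1 ≤ m (Set.Iic s) := fun s =>
          le_trans le_add_self ((qt_le_iff i m s).1 (by simp [hb]))
        have hI : (∅ : Set ℝ) = ⋂ n : ℕ, Set.Iic (-(n : ℝ)) := by
          symm
          rw [Set.eq_empty_iff_forall_notMem]
          intro x hx
          obtain ⟨n, hn⟩ := exists_nat_gt (-x)
          have := Set.mem_iInter.1 hx n
          simp only [Set.mem_Iic] at this
          linarith
        have ht := tendsto_measure_iInter_atTop (μ := m) (s := fun n : ℕ => Set.Iic (-(n : ℝ)))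
          (fun n => measurableSet_Iic.nullMeasurableSet)
          (fun a b hab => Set.Iic_subset_Iic.2 (by
            have : (a : ℝ) ≤ b := by exact_mod_cast hab
            linarith)) ⟨0, measure_ne_top _ _⟩
        rw [← hI, measure_empty] at ht
        obtain ⟨n, hn⟩ := (ht.eventually_lt_const one_pos).exists
        exact absurd (hb2 _) (not_le.2 hn)
      have htop : qt i m ≠ ⊤ := by
        intro ht; rw [ht] at h3; simp at h3
      rw [Measure.dirac_apply' _ measurableSet_Iic, Set.indicator_of_mem]; · rfl
      rw [Set.mem_Iic, ← EReal.coe_le_coe_iff, EReal.coe_toReal htop hbot]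
      exact h3
    · have h3 : ¬ qt i m ≤ t := fun h4 => h2 (hk ▸ (qt_le_iff i m t).1 h4)
      have htop : qt i m ≠ ⊤ := by
        have ht := tendsto_measure_Iic_atTop m
        have : (i : ℝ≥0∞) < m Set.univ := lt_of_lt_of_le (ENNReal.lt_add_right (by simp) (by simp)) h1
        obtain ⟨s, hs⟩ := (ht.eventually_const_lt this).exists
        obtain ⟨l, hl⟩ := h s
        have : (i : ℝ≥0∞) + 1 ≤ m (Set.Iic s) := by
          rw [hl] at hs ⊢
          exact_mod_cast hs
        intro h5
        have := (qt_le_iff i m s).2 this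
        rw [h5] at this; simp at this
      have hbot : qt i m ≠ ⊥ := fun h5 => h3 (by simp [h5])
      rw [Measure.dirac_apply' _ measurableSet_Iic, Set.indicator_of_notMem]
      rw [Set.mem_Iic, ← EReal.coe_le_coe_iff, EReal.coe_toReal htop hbot]
      exact h3
    · exact absurd ((h2.trans hk.ge).trans (measure_mono (Set.subset_univ _))) h1
    · simp
  simp_rw [this, tsum_lt_count, hk]

section pieces
variable {X : Type*} [MeasurableSpace X]

lemma restrict_measurable {s : Set X} (hs : MeasurableSet s) :
    Measurable (fun μ : Measure X => μ.restrict s) := by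
  refine Measure.measurable_of_measurable_coe _ fun t ht => ?_
  simp_rw [Measure.restrict_apply ht]
  exact Measure.measurable_coe (ht.inter hs)

lemma ite_measurable {α β : Type*} [MeasurableSpace α] [MeasurableSpace β] {p : α → Prop}
    [DecidablePred p] (hp : MeasurableSet {a | p a}) {f g : α → β} (hf : Measurable f)
    (hg : Measurable g) : Measurable (fun a => if p a then f a else g a) := Measurable.ite hp hf hg

open Classical in
/-- What remains after removing the first `n` sets of finite measure. -/
def rem (U : ℕ → Set X) (μ : Measure X) : ℕ → Set X
  | 0 => Set.univ
  | n + 1 => if μ (U n) < ∞ then rem U μ n \ U n else rem U μ n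

open Classical in
def pc (U : ℕ → Set X) (μ : Measure X) (n : ℕ) : Set X :=
  if μ (U n) < ∞ then rem U μ n ∩ U n else ∅

lemma mem_rem (U : ℕ → Set X) (μ : Measure X) (n : ℕ) (x : X) :
    x ∈ rem U μ n ↔ ∀ m < n, μ (U m) < ∞ → x ∉ U m := by
  induction n with
  | zero => simp [rem]
  | succ n ih =>
    unfold rem
    constructor
    · intro h m hm hf
      split_ifs at h with hc
      · rcases Nat.lt_succ_iff_lt_or_eq.1 hm with h1 | rfl
        · exact (ih.1 h.1) m h1 hf
        · exact h.2
      · rcases Nat.lt_succ_iff_lt_or_eq.1 hm with h1 | rfl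
        · exact (ih.1 h) m h1 hf
        · exact absurd hf hc
    · intro h
      have h1 := ih.2 fun m hm => h m (by omega)
      split_ifs with hc
      · exact ⟨h1, h n (by omega) hc⟩
      · exact h1

lemma rem_measurableSet {U : ℕ → Set X} (hU : ∀ n, MeasurableSet (U n)) (μ : Measure X) (n : ℕ) :
    MeasurableSet (rem U μ n) := by
  induction n with
  | zero => simp [rem]
  | succ n ih => unfold rem; split_ifs; exacts [ih.diff (hU n), ih]

lemma pc_measurableSet {U : ℕ → Set X} (hU : ∀ n, MeasurableSet (U n)) (μ : Measure X) (n : ℕ) :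
    MeasurableSet (pc U μ n) := by
  unfold pc; split_ifs; exacts [(rem_measurableSet hU μ n).inter (hU n), MeasurableSet.empty]

lemma rem_restrict_measurable {U : ℕ → Set X} (hU : ∀ n, MeasurableSet (U n)) (n : ℕ) :
    Measurable (fun μ : Measure X => μ.restrict (rem U μ n)) := by
  classical
  induction n with
  | zero => simp only [rem, Measure.restrict_univ]; exact measurable_id
  | succ n ih =>
    have : (fun μ : Measure X => μ.restrict (rem U μ (n + 1))) = fun μ =>
        if μ (U n) < ∞ then (μ.restrict (rem U μ n)).restrict (U n)ᶜ else μ.restrict (rem U μ n) := by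
      funext μ
      rw [rem]
      split_ifs with h
      · rw [Measure.restrict_restrict (hU n).compl, Set.sdiff_eq, Set.inter_comm]
      · rfl
    rw [this]
    exact ite_measurable (measurableSet_lt (Measure.measurable_coe (hU n)) measurable_const)
      ((restrict_measurable (hU n).compl).comp ih) ih

lemma pc_restrict_measurable {U : ℕ → Set X} (hU : ∀ n, MeasurableSet (U n)) (n : ℕ) :
    Measurable (fun μ : Measure X => μ.restrict (pc U μ n)) := by
  classical
  have : (fun μ : Measure X => μ.restrict (pc U μ n)) = fun μ =>
      if μ (U n) < ∞ then (μ.restrict (rem U μ n)).restrict (U n) else 0 := by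
    funext μ
    rw [pc]
    split_ifs with h
    · rw [Measure.restrict_restrict (hU n), Set.inter_comm]
    · simp
  rw [this]
  exact ite_measurable (measurableSet_lt (Measure.measurable_coe (hU n)) measurable_const)
      ((restrict_measurable (hU n)).comp (rem_restrict_measurable hU n)) measurable_const

lemma pc_finite (U : ℕ → Set X) (μ : Measure X) (n : ℕ) : μ (pc U μ n) < ∞ := by
  unfold pc
  split_ifs with h
  · exact (measure_mono Set.inter_subset_right).trans_lt h
  · simp

lemma pc_disjoint (U : ℕ → Set X) (μ : Measure X) :
    Pairwise (Function.onFun Disjoint (pc U μ)) := by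
  have key : ∀ m n, m < n → Disjoint (pc U μ m) (pc U μ n) := by
    intro m n hmn
    rw [Set.disjoint_left]
    intro x hx hy
    unfold pc at hx hy
    split_ifs at hx hy with h1 h2
    · exact (mem_rem U μ n x).1 hy.1 m hmn h1 hx.2
    all_goals simp_all
  intro m n hmn
  rcases lt_or_gt_of_ne hmn with h | h
  · exact key m n h
  · exact (key n m h).symm

lemma pc_union (U : ℕ → Set X) (μ : Measure X) (h : ∀ x, ∃ n, x ∈ U n ∧ μ (U n) < ∞) :
    ⋃ n, pc U μ n = Set.univ := by
  classical
  rw [Set.eq_univ_iff_forall]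
  intro x
  rw [Set.mem_iUnion]
  refine ⟨Nat.find (h x), ?_⟩
  obtain ⟨h1, h2⟩ := Nat.find_spec (h x)
  rw [pc, if_pos h2]
  refine ⟨(mem_rem _ _ _ _).2 fun m hm hf hx => Nat.find_min (h x) hm ⟨hx, hf⟩, h1⟩

end pieces

variable {X : Type*} [MeasurableSpace X] [MetricSpace X]

lemma pm_apply_nat {μ : Measure X} (h : IsPointMeasure μ) {A : Set X} (hA : MeasurableSet A) :
    μ A = ∞ ∨ ∃ k : ℕ, μ A = k := by
  obtain ⟨⟨D, hD⟩, -⟩ := h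
  rw [hD, Measure.sum_apply _ hA]
  refine tsum_zero_one _ fun n => ?_
  cases D n with
  | none => simp
  | some x =>
    by_cases hx : x ∈ A <;> simp [Measure.dirac_apply' _ hA, hx]

lemma exists_enum [PolishSpace X] [BorelSpace X] :
    ∃ D : ℕ → Measure X → Measure X, (∀ j, Measurable (D j)) ∧
      (∀ j μ, D j μ = 0 ∨ ∃ x, D j μ = Measure.dirac x) ∧
      ∀ μ, IsPointMeasure μ → μ = Measure.sum (fun j => D j μ) := by
  classical
  rcases isEmpty_or_nonempty X with hX | hX
  · exact ⟨fun _ _ => 0, fun j => measurable_const, fun j μ => Or.inl rfl,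
      fun μ _ => Subsingleton.elim _ _⟩
  obtain ⟨e, he⟩ := exists_measurableEmbedding_real X
  obtain ⟨g, hg, hge⟩ := he.exists_measurable_extend measurable_id (fun _ => hX)
  obtain ⟨U, hU⟩ : ∃ U : ℕ → Set X, TopologicalSpace.countableBasis X = Set.range U :=
    (TopologicalSpace.countable_countableBasis X).exists_eq_range
      (by
        obtain ⟨x⟩ := hX
        obtain ⟨t, ht, -, -⟩ := (TopologicalSpace.isBasis_countableBasis X).exists_subset_of_mem_open
          (Set.mem_univ x) isOpen_univ
        exact ⟨t, ht⟩)
  have hUo : ∀ n, IsOpen (U n) := fun n =>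
    TopologicalSpace.isOpen_of_mem_countableBasis (hU ▸ ⟨n, rfl⟩)
  have hUm : ∀ n, MeasurableSet (U n) := fun n => (hUo n).measurableSet
  let F : ℕ → Measure X → Measure ℝ := fun n μ => (μ.restrict (pc U μ n)).map e
  have hF : ∀ n, Measurable (F n) := fun n =>
    (Measure.measurable_map e he.measurable).comp (pc_restrict_measurable hUm n)
  let D' : ℕ × ℕ → Measure X → Measure X := fun p μ => (qd p.2 (F p.1 μ)).map g
  have hD' : ∀ p μ, D' p μ = if ((p.2 : ℝ≥0∞) + 1) ≤ F p.1 μ Set.univ then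
      Measure.dirac (g (qt p.2 (F p.1 μ)).toReal) else 0 := by
    intro p μ
    simp only [D', qd]
    split_ifs
    · exact Measure.map_dirac' hg _
    · simp
  refine ⟨fun j => D' (Nat.pairEquiv.symm j), fun j => ?_, fun j μ => ?_, fun μ hμ => ?_⟩
  · have : D' (Nat.pairEquiv.symm j) = fun μ => _ := funext (hD' _)
    beta_reduce
    rw [this]
    refine ite_measurable ?_ ?_ measurable_const
    · exact measurableSet_le measurable_const ((Measure.measurable_coe MeasurableSet.univ).comp (hF _))
    · exact Measure.measurable_dirac.comp (hg.comp (((qt_measurable _).comp (hF _)).ereal_toReal))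
  · beta_reduce
    rw [hD']
    split_ifs
    · exact Or.inr ⟨_, rfl⟩
    · exact Or.inl rfl
  · have hfin : ∀ n, IsFiniteMeasure (μ.restrict (pc U μ n)) := fun n =>
      ⟨by simpa using pc_finite U μ n⟩
    have hFf : ∀ n, IsFiniteMeasure (F n μ) := fun n => Measure.isFiniteMeasure_map _ _
    have hpiece : ∀ n, μ.restrict (pc U μ n) = Measure.sum (fun i => D' (n, i) μ) := by
      intro n
      have h1 : F n μ = Measure.sum (fun i => qd i (F n μ)) := by
        refine qd_sum _ fun t => ?_
        simp only [F]
        rw [Measure.map_apply he.measurable measurableSet_Iic,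
          Measure.restrict_apply (he.measurable measurableSet_Iic)]
        rcases pm_apply_nat hμ ((he.measurable measurableSet_Iic).inter (pc_measurableSet hUm μ n))
          with h2 | h2
        · exact absurd ((measure_mono Set.inter_subset_right).trans_lt (pc_finite U μ n)) (by
            rw [h2]; simp)
        · exact h2
      have h2 : μ.restrict (pc U μ n) = (F n μ).map g := by
        simp only [F]
        rw [Measure.map_map hg he.measurable, hge, Measure.map_id]
      rw [h2]
      conv_lhs => rw [h1]
      rw [Measure.map_sum hg.aemeasurable]
    have hall : μ = Measure.sum (fun n => μ.restrict (pc U μ n)) := by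
      rw [← Measure.restrict_iUnion (pc_disjoint U μ) (pc_measurableSet hUm μ), pc_union,
        Measure.restrict_univ]
      intro x
      have := hμ.2
      obtain ⟨s, hs, hsf⟩ := μ.exists_isOpen_measure_lt_top x
      obtain ⟨t, ht, hxt, hts⟩ := (TopologicalSpace.isBasis_countableBasis X).exists_subset_of_mem_open
        hs hsf.1
      rw [hU] at ht
      obtain ⟨n, rfl⟩ := ht
      exact ⟨n, hxt, (measure_mono hts).trans_lt hsf.2⟩
    conv_lhs => rw [hall]
    simp_rw [hpiece]
    rw [Measure.sum_sum]
    exact (Measure.sum_comp_equiv Nat.pairEquiv.symm (fun p => D' p μ)).symm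

end PoissonSplitting

namespace PoissonSplitting

section Sub
variable {X : Type*} [MeasurableSpace X]

lemma add_sub_sfin (R ν : Measure X) [SigmaFinite ν] : (R + ν) - ν = R := by
  refine le_antisymm (Measure.sub_le_of_le_add le_rfl) ?_
  rw [Measure.sub_def]
  refine le_sInf fun d hd => ?_
  rw [Set.mem_ofPred_eq] at hd
  rw [Measure.le_iff]
  intro A hA
  have hmono : Monotone fun n => A ∩ spanningSets ν n := fun a b hab =>
    Set.inter_subset_inter_right _ (monotone_spanningSets ν hab)
  have hU : A = ⋃ n, A ∩ spanningSets ν n := by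
    rw [← Set.inter_iUnion, iUnion_spanningSets, Set.inter_univ]
  rw [hU, hmono.measure_iUnion]
  refine iSup_le fun n => ?_
  refine le_trans ?_ (measure_mono (Set.subset_iUnion _ n))
  have h1 := Measure.le_iff.1 hd _ (hA.inter (measurableSet_spanningSets ν n))
  simp only [Measure.add_apply] at h1
  have hf : ν (A ∩ spanningSets ν n) ≠ ∞ :=
    ((measure_mono Set.inter_subset_right).trans_lt (measure_spanningSets_lt_top ν n)).ne
  exact (ENNReal.add_le_add_iff_right hf).1 h1

lemma atomic_repr [MeasurableSingletonClass X] {a : Set X} (ha : a.Countable) (κ : Measure X)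
    (hκ : κ aᶜ = 0) : κ = Measure.sum (fun x : a => κ {(x : X)} • Measure.dirac (x : X)) := by
  ext A hA
  rw [Measure.sum_apply _ hA]
  have h1 : κ A = κ (⋃ x ∈ a, {x} ∩ A) := by
    have : (⋃ x ∈ a, {x} ∩ A) = A ∩ a := by
      ext y; simp [and_comm]
    rw [this]
    exact (measure_inter_conull hκ).symm
  rw [h1, measure_biUnion ha]
  · refine tsum_congr fun x => ?_
    rw [Measure.smul_apply, Measure.dirac_apply' _ hA, smul_eq_mul]
    by_cases hx : (x : X) ∈ A
    · have : {(x : X)} ∩ A = {(x : X)} := by simpa using hx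
      rw [this]; simp [hx]
    · have : {(x : X)} ∩ A = ∅ := by simpa using hx
      rw [this]; simp [hx]
  · intro x _ y _ hxy
    rw [Function.onFun, Set.disjoint_left]
    rintro z ⟨hz, -⟩ ⟨hz', -⟩
    exact hxy (hz.symm.trans hz')
  · exact fun x _ => (measurableSet_singleton x).inter hA

lemma sum_option_countable {ι : Type*} [Countable ι] (E : ι → Option X) :
    ∃ D : ℕ → Option X, Measure.sum (fun i => (E i).elim 0 Measure.dirac) =
      Measure.sum (fun n => (D n).elim 0 Measure.dirac) := by
  classical
  have := Encodable.ofCountable ι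
  refine ⟨fun n => (Encodable.decode₂ ι n).bind E, ?_⟩
  ext A hA
  rw [Measure.sum_apply _ hA, Measure.sum_apply _ hA]
  rw [← (Encodable.encode_injective (α := ι)).tsum_eq]
  · refine tsum_congr fun i => ?_
    simp
  · intro n hn
    by_contra hc
    have : Encodable.decode₂ ι n = none := by
      rw [Option.eq_none_iff_forall_ne_some]
      intro i hi
      exact hc ⟨i, Encodable.mem_decode₂.1 hi⟩
    simp [this] at hn

end Sub

variable {X : Type*} [MeasurableSpace X] [MetricSpace X]

/-- the selected points -/
def Gt (D : ℕ → Measure X → Measure X) (μ : Measure X) (ω : ℕ → Bool) : Measure X :=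
  Measure.sum fun j => if ω j = true then D j μ else 0

/-- the non-selected points -/
def Gf (D : ℕ → Measure X → Measure X) (μ : Measure X) (ω : ℕ → Bool) : Measure X :=
  Measure.sum fun j => if ω j = true then 0 else D j μ

def bern (q : ℝ) (_ : q ∈ Set.Ioo (0 : ℝ) 1) : Measure Bool :=
  ENNReal.ofReal q • Measure.dirac true + ENNReal.ofReal (1 - q) • Measure.dirac false

instance (q : ℝ) (hq : q ∈ Set.Ioo (0 : ℝ) 1) : IsProbabilityMeasure (bern q hq) := ⟨by
  simp only [bern, Measure.add_apply, Measure.smul_apply, measure_univ, smul_eq_mul, mul_one]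
  rw [← ENNReal.ofReal_add hq.1.le (by linarith [hq.2])]
  simp⟩

def coins (q : ℝ) (hq : q ∈ Set.Ioo (0 : ℝ) 1) : Measure (ℕ → Bool) :=
  Measure.infinitePi fun _ => bern q hq

instance (q : ℝ) (hq : q ∈ Set.Ioo (0 : ℝ) 1) : IsProbabilityMeasure (coins q hq) := by
  unfold coins; infer_instance

lemma bern_lintegral (q : ℝ) (hq : q ∈ Set.Ioo (0 : ℝ) 1) (f : Bool → ℝ≥0∞) :
    ∫⁻ b, f b ∂(bern q hq) = ENNReal.ofReal q * f true + ENNReal.ofReal (1 - q) * f false := by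
  simp [bern, lintegral_add_measure, lintegral_smul_measure]

section
variable {D : ℕ → Measure X → Measure X}

lemma Gt_measurable (hD : ∀ j, Measurable (D j)) :
    Measurable (fun p : Measure X × (ℕ → Bool) => Gt D p.1 p.2) := by
  refine Measure.measurable_of_measurable_coe _ fun s hs => ?_
  simp only [Gt, Measure.sum_apply _ hs]
  refine Measurable.tsum fun j => ?_
  have : ∀ p : Measure X × (ℕ → Bool), (if p.2 j = true then D j p.1 else 0) s =
      if p.2 j = true then D j p.1 s else 0 := by intro p; split_ifs <;> simp
  simp_rw [this]
  refine ite_measurable ?_ (((Measure.measurable_coe hs).comp (hD j)).comp measurable_fst)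
    measurable_const
  have hj : Measurable (fun p : Measure X × (ℕ → Bool) => p.2 j) :=
    (measurable_pi_apply j).comp measurable_snd
  exact hj (measurableSet_singleton true)

lemma Gf_measurable (hD : ∀ j, Measurable (D j)) :
    Measurable (fun p : Measure X × (ℕ → Bool) => Gf D p.1 p.2) := by
  refine Measure.measurable_of_measurable_coe _ fun s hs => ?_
  simp only [Gf, Measure.sum_apply _ hs]
  refine Measurable.tsum fun j => ?_
  have : ∀ p : Measure X × (ℕ → Bool), (if p.2 j = true then 0 else D j p.1) s =
      if p.2 j = true then 0 else D j p.1 s := by intro p; split_ifs <;> simp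
  simp_rw [this]
  refine ite_measurable ?_ measurable_const (((Measure.measurable_coe hs).comp (hD j)).comp measurable_fst)
  have hj : Measurable (fun p : Measure X × (ℕ → Bool) => p.2 j) :=
    (measurable_pi_apply j).comp measurable_snd
  exact hj (measurableSet_singleton true)

lemma Gt_add_Gf (μ : Measure X) (ω : ℕ → Bool) (h : μ = Measure.sum (fun j => D j μ)) :
    Gf D μ ω + Gt D μ ω = μ := by
  conv_rhs => rw [h]
  rw [Gf, Gt, Measure.sum_add_sum]
  congr 1; funext j
  split_ifs <;> simp

/-- logarithmic mixture -/
def mixLog (q : ℝ) (f g : X → ℝ) (x : X) : ℝ :=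
  -Real.log (q * Real.exp (-f x) + (1 - q) * Real.exp (-g x))

lemma coins_laplace (q : ℝ) (hq : q ∈ Set.Ioo (0 : ℝ) 1) (μ : Measure X)
    (h01 : ∀ j, D j μ = 0 ∨ ∃ x, D j μ = Measure.dirac x)
    (hs : μ = Measure.sum (fun j => D j μ)) {f g : X → ℝ} (hf : MemU f) (hg : MemU g) :
    ∫⁻ ω, expNeg (pairing f (Gt D μ ω)) * expNeg (pairing g (Gf D μ ω)) ∂(coins q hq) =
      expNeg (pairing (mixLog q f g) μ) := by
  have hmm : Measurable (mixLog q f g) := by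
    have := hf.1; have := hg.1
    unfold mixLog; fun_prop
  let a : ℕ → Bool → ℝ≥0∞ := fun j b => if b = true then pairing f (D j μ) else pairing g (D j μ)
  have h1 : ∀ ω, expNeg (pairing f (Gt D μ ω)) * expNeg (pairing g (Gf D μ ω)) =
      expNeg (∑' j, a j (ω j)) := by
    intro ω
    rw [← expNeg_add]
    congr 1
    unfold pairing Gt Gf
    rw [lintegral_sum_measure, lintegral_sum_measure, ← ENNReal.tsum_add]
    refine tsum_congr fun j => ?_
    simp only [a, pairing]
    split_ifs <;> simp
  have h2 : pairing (mixLog q f g) μ = ∑' j, pairing (mixLog q f g) (D j μ) := by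
    conv_lhs => rw [hs]
    unfold pairing
    rw [lintegral_sum_measure]
  have h3 : ∀ j, ∫⁻ ω, expNeg (a j (ω j)) ∂(coins q hq) = expNeg (pairing (mixLog q f g) (D j μ)) := by
    intro j
    have e1 : ∫⁻ ω, expNeg (a j (ω j)) ∂(coins q hq) = ∫⁻ b, expNeg (a j b) ∂(bern q hq) :=
      (measurePreserving_eval_infinitePi (fun _ : ℕ => bern q hq) j).lintegral_comp
        (f := fun b => expNeg (a j b)) (measurable_of_finite _)
    rw [e1, bern_lintegral]
    simp only [a, if_true, Bool.false_eq_true, if_false]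
    have hq1 : 0 < 1 - q := by linarith [hq.2]
    rcases h01 j with h | ⟨x, h⟩
    · rw [h]
      simp only [pairing, lintegral_zero_measure, expNeg_zero, mul_one]
      rw [← ENNReal.ofReal_add hq.1.le hq1.le]; simp
    · rw [h]
      simp only [pairing]
      rw [lintegral_dirac' x hf.1.ennreal_ofReal, lintegral_dirac' x hg.1.ennreal_ofReal,
        lintegral_dirac' x hmm.ennreal_ofReal, expNeg_ofReal (hf.2.1 x), expNeg_ofReal (hg.2.1 x)]
      have e2 : Real.exp (-f x) ≤ 1 := Real.exp_le_one_iff.2 (by linarith [hf.2.1 x])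
      have e3 : Real.exp (-g x) ≤ 1 := Real.exp_le_one_iff.2 (by linarith [hg.2.1 x])
      have e4 : 0 < q * Real.exp (-f x) + (1 - q) * Real.exp (-g x) := by
        have := hq.1; positivity
      rw [expNeg_ofReal, mixLog, neg_neg, Real.exp_log e4, ← ENNReal.ofReal_mul hq.1.le,
        ← ENNReal.ofReal_mul hq1.le, ← ENNReal.ofReal_add]
      · have := hq.1; positivity
      · positivity
      · unfold mixLog
        have : Real.log (q * Real.exp (-f x) + (1 - q) * Real.exp (-g x)) ≤ 0 :=
          Real.log_nonpos e4.le (by nlinarith [hq.1])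
        linarith
  simp_rw [h1, h2]
  have hma : ∀ j, Measurable fun ω : ℕ → Bool => expNeg (a j (ω j)) := fun j =>
    (measurable_of_finite (fun b => expNeg (a j b))).comp (measurable_pi_apply j)
  have hind : ProbabilityTheory.iIndepFun (fun j (ω : ℕ → Bool) => expNeg (a j (ω j))) (coins q hq) :=
    ProbabilityTheory.iIndepFun_infinitePi (P := fun _ : ℕ => bern q hq)
      (X := fun j b => expNeg (a j b)) (fun j => measurable_of_finite _)
  have L1 : Filter.Tendsto (fun n => ∫⁻ ω, ∏ j ∈ Finset.range n, expNeg (a j (ω j)) ∂(coins q hq))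
      Filter.atTop (nhds (∫⁻ ω, expNeg (∑' j, a j (ω j)) ∂(coins q hq))) := by
    refine tendsto_lintegral_of_dominated_convergence (fun _ => 1) ?_ ?_ ?_ ?_
    · exact fun n => Finset.measurable_fun_prod _ fun j _ => hma j
    · exact fun n => ae_of_all _ fun ω => Finset.prod_le_one' fun j _ => expNeg_le_one _
    · simp
    · exact ae_of_all _ fun ω => tendsto_expNeg_tsum _
  have L2 : Filter.Tendsto (fun n => ∫⁻ ω, ∏ j ∈ Finset.range n, expNeg (a j (ω j)) ∂(coins q hq))
      Filter.atTop (nhds (expNeg (∑' j, pairing (mixLog q f g) (D j μ)))) := by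
    have : ∀ n, ∫⁻ ω, ∏ j ∈ Finset.range n, expNeg (a j (ω j)) ∂(coins q hq) =
        ∏ j ∈ Finset.range n, expNeg (pairing (mixLog q f g) (D j μ)) := by
      intro n
      rw [ProbabilityTheory.lintegral_prod_eq_prod_lintegral_of_indepFun _ _ hind hma]
      exact Finset.prod_congr rfl fun j _ => h3 j
    simp_rw [this]
    exact tendsto_expNeg_tsum _
  exact tendsto_nhds_unique L1 L2

/-- atoms of `μ` -/
def atoms (D : ℕ → Measure X → Measure X) (μ : Measure X) : Set X :=
  ⋃ j, {x | D j μ = Measure.dirac x}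

lemma atoms_countable [BorelSpace X] (μ : Measure X) : (atoms D μ).Countable := by
  refine Set.countable_iUnion fun j => Set.Subsingleton.countable ?_
  intro x hx y hy
  have : Measure.dirac x = Measure.dirac y := hx.symm.trans hy
  by_contra hne
  have h2 := congrArg (fun κ => κ {x}) this
  simp [Ne.symm hne] at h2

/-- good subconfigurations -/
def good (D : ℕ → Measure X → Measure X) (μ : Measure X) : Set (Measure X) :=
  {ν | ν (atoms D μ)ᶜ = 0} ∩ ⋂ x ∈ atoms D μ, {ν | ν {x} ≤ μ {x}} ∩
    {ν | ν {x} ∈ ({∞} ∪ Set.range (fun k : ℕ => (k : ℝ≥0∞)))}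

lemma good_measurable [BorelSpace X] (μ : Measure X) : MeasurableSet (good D μ) := by
  have hc := atoms_countable (D := D) μ
  refine MeasurableSet.inter ?_ (MeasurableSet.biInter hc fun x _ => MeasurableSet.inter ?_ ?_)
  · exact Measure.measurable_coe hc.measurableSet.compl (measurableSet_singleton 0)
  · exact measurableSet_le (Measure.measurable_coe (measurableSet_singleton x)) measurable_const
  · exact Measure.measurable_coe (measurableSet_singleton x)
      (((Set.countable_singleton _).union (Set.countable_range _)).measurableSet)

lemma null_compl_atoms [BorelSpace X] (μ : Measure X)
    (h01 : ∀ j, D j μ = 0 ∨ ∃ x, D j μ = Measure.dirac x) (hs : μ = Measure.sum (fun j => D j μ)) :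
    μ (atoms D μ)ᶜ = 0 := by
  have hm := (atoms_countable (D := D) μ).measurableSet.compl
  have : Measure.sum (fun j => D j μ) (atoms D μ)ᶜ = 0 := by
    rw [Measure.sum_apply _ hm, ENNReal.tsum_eq_zero]
    intro j
    rcases h01 j with h | ⟨x, h⟩
    · simp [h]
    · have : x ∈ atoms D μ := Set.mem_iUnion.2 ⟨j, h⟩
      rw [h, Measure.dirac_apply' _ hm]; simp [this]
  rwa [← hs] at this

lemma Gt_le (μ : Measure X) (ω : ℕ → Bool) (h : μ = Measure.sum (fun j => D j μ)) :
    Gt D μ ω ≤ μ := by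
  conv_rhs => rw [← Gt_add_Gf μ ω h]
  exact Measure.le_add_left le_rfl

lemma Gf_le (μ : Measure X) (ω : ℕ → Bool) (h : μ = Measure.sum (fun j => D j μ)) :
    Gf D μ ω ≤ μ := by
  conv_rhs => rw [← Gt_add_Gf μ ω h]
  exact Measure.le_add_right le_rfl

lemma Gt_good [BorelSpace X] (μ : Measure X) (ω : ℕ → Bool)
    (h01 : ∀ j, D j μ = 0 ∨ ∃ x, D j μ = Measure.dirac x) (hs : μ = Measure.sum (fun j => D j μ)) :
    Gt D μ ω ∈ good D μ := by
  refine ⟨le_antisymm ((Gt_le μ ω hs _).trans_eq (null_compl_atoms μ h01 hs)) bot_le, ?_⟩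
  refine Set.mem_iInter₂.2 fun x hx => ⟨Gt_le μ ω hs _, ?_⟩
  rw [Set.mem_ofPred_eq, Gt, Measure.sum_apply _ (measurableSet_singleton x)]
  have h0 : ∀ j, (if ω j = true then D j μ else 0) {x} = 0 ∨
      (if ω j = true then D j μ else 0) {x} = 1 := by
    intro j
    split_ifs
    · rcases h01 j with h | ⟨y, h⟩
      · simp [h]
      · rw [h]; by_cases hxy : y = x <;> simp [hxy]
    · simp
  rcases tsum_zero_one (fun j => (if ω j = true then D j μ else 0) {x}) h0 with h | ⟨k, h⟩
  · left; exact h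
  · right; exact ⟨k, h.symm⟩

lemma Gf_good [BorelSpace X] (μ : Measure X) (ω : ℕ → Bool)
    (h01 : ∀ j, D j μ = 0 ∨ ∃ x, D j μ = Measure.dirac x) (hs : μ = Measure.sum (fun j => D j μ)) :
    Gf D μ ω ∈ good D μ := by
  have : Gf D μ ω = Gt D μ (fun j => !(ω j)) := by
    unfold Gt Gf; congr 1; funext j
    cases h : ω j <;> simp [h]
  rw [this]; exact Gt_good μ _ h01 hs

lemma good_le [BorelSpace X] (μ : Measure X)
    (h01 : ∀ j, D j μ = 0 ∨ ∃ x, D j μ = Measure.dirac x) (hs : μ = Measure.sum (fun j => D j μ))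
    {ν : Measure X} (hν : ν ∈ good D μ) : ν ≤ μ := by
  have hc := atoms_countable (D := D) μ
  rw [Measure.le_iff]
  intro A hA
  have e1 := congrArg (fun κ => κ A) (atomic_repr hc ν hν.1)
  have e2 := congrArg (fun κ => κ A) (atomic_repr hc μ (null_compl_atoms μ h01 hs))
  beta_reduce at e1 e2
  refine e1.trans_le (le_trans ?_ e2.symm.le)
  rw [Measure.sum_apply _ hA, Measure.sum_apply _ hA]
  refine ENNReal.tsum_le_tsum fun x => ?_
  simp only [Measure.smul_apply, smul_eq_mul]
  exact mul_le_mul_left (Set.mem_iInter₂.1 hν.2 x x.2).1 _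

lemma le_locFin {μ ν : Measure X} (h : ν ≤ μ) (hμ : IsLocallyFiniteMeasure μ) :
    IsLocallyFiniteMeasure ν :=
  ⟨fun x => by obtain ⟨s, hs, hf⟩ := hμ.1 x; exact ⟨s, hs, (h s).trans_lt hf⟩⟩

lemma good_pm [BorelSpace X] (μ : Measure X) (hμ : IsPointMeasure μ)
    (h01 : ∀ j, D j μ = 0 ∨ ∃ x, D j μ = Measure.dirac x) (hs : μ = Measure.sum (fun j => D j μ))
    {ν : Measure X} (hν : ν ∈ good D μ) : IsPointMeasure ν := by
  classical
  have hle := good_le μ h01 hs hν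
  have hlf := le_locFin hle hμ.2
  refine ⟨?_, hlf⟩
  have hc := atoms_countable (D := D) μ
  have := hc.to_subtype
  obtain ⟨E, hE⟩ := sum_option_countable (ι := atoms D μ × ℕ)
    (fun p => if ((p.2 : ℝ≥0∞) + 1) ≤ ν {(p.1 : X)} then some (p.1 : X) else none)
  refine ⟨E, ?_⟩
  rw [← hE]
  conv_lhs => rw [atomic_repr hc ν hν.1]
  ext A hA
  rw [Measure.sum_apply _ hA, Measure.sum_apply _ hA, ENNReal.tsum_prod']
  refine tsum_congr fun x => ?_
  have hx := (Set.mem_iInter₂.1 hν.2 x x.2).2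
  have hfin : ν {(x : X)} ≠ ∞ := by
    have := (isCompact_singleton (x := (x : X))).measure_lt_top (μ := ν)
    exact this.ne
  obtain ⟨k, hk⟩ : ∃ k : ℕ, (k : ℝ≥0∞) = ν {(x : X)} := by
    rcases hx with h | h
    · exact absurd h hfin
    · exact h
  rw [← hk, Measure.smul_apply, smul_eq_mul]
  conv_lhs => rw [← tsum_lt_count k]
  rw [← ENNReal.tsum_mul_right]
  refine tsum_congr fun i => ?_
  beta_reduce
  rw [← hk]
  split_ifs <;> simp

/-- measurable version of `μ - ν` -/
def rest (D : ℕ → Measure X → Measure X) (μ ν : Measure X) : Measure X :=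
  Measure.sum (fun x : atoms D μ => (μ {(x : X)} - ν {(x : X)}) • Measure.dirac (x : X))

lemma rest_measurable [BorelSpace X] (μ : Measure X) : Measurable (rest D μ) := by
  have := (atoms_countable (D := D) μ).to_subtype
  refine Measure.measurable_of_measurable_coe _ fun s hs => ?_
  simp only [rest, Measure.sum_apply _ hs, Measure.smul_apply, smul_eq_mul]
  refine Measurable.tsum fun x => Measurable.mul_const ?_ _
  exact measurable_const.sub (Measure.measurable_coe (measurableSet_singleton _))

lemma rest_eq [PolishSpace X] [BorelSpace X] (μ : Measure X) (hμ : IsPointMeasure μ)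
    (h01 : ∀ j, D j μ = 0 ∨ ∃ x, D j μ = Measure.dirac x) (hs : μ = Measure.sum (fun j => D j μ))
    {ν : Measure X} (hν : ν ∈ good D μ) : μ - ν = rest D μ ν := by
  have hc := atoms_countable (D := D) μ
  have hlf := le_locFin (good_le μ h01 hs hν) hμ.2
  have : rest D μ ν + ν = μ := by
    conv_rhs => rw [atomic_repr hc μ (null_compl_atoms μ h01 hs)]
    conv_lhs => rw [atomic_repr hc ν hν.1]
    have hr : rest D μ (Measure.sum fun x : atoms D μ => ν {(x : X)} • Measure.dirac (x : X)) = rest D μ ν := by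
      rw [← atomic_repr hc ν hν.1]
    rw [hr, rest, Measure.sum_add_sum]
    congr 1; funext x
    rw [← add_smul, tsub_add_cancel_of_le (Set.mem_iInter₂.1 hν.2 x x.2).1]
  conv_lhs => rw [← this]
  exact add_sub_sfin _ _

end

end PoissonSplitting

namespace PoissonSplitting

variable {X : Type*} [MeasurableSpace X] [MetricSpace X]

/-- a measurable enumeration of the points of point measures -/
structure EnumData (D : ℕ → Measure X → Measure X) : Prop where
  meas : ∀ j, Measurable (D j)
  zo : ∀ j μ, D j μ = 0 ∨ ∃ x, D j μ = Measure.dirac x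
  sum : ∀ μ, IsPointMeasure μ → μ = Measure.sum (fun j => D j μ)

lemma exists_enumData [PolishSpace X] [BorelSpace X] :
    ∃ D : ℕ → Measure X → Measure X, EnumData D := by
  obtain ⟨D, h1, h2, h3⟩ := exists_enum (X := X)
  exact ⟨D, h1, h2, h3⟩

lemma eP_measurable {f : X → ℝ} (hf : MemU f) :
    Measurable (fun ν : Measure X => expNeg (pairing f ν)) :=
  expNeg_measurable.comp (pairing_measurable hf)

lemma comp_left {A B C : Type*} [MeasurableSpace A] [MeasurableSpace B] [MeasurableSpace C]
    (f : A → B → C) (h : Measurable (fun p : A × B => f p.1 p.2)) (a : A) :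
    Measurable (fun b => f a b) := h.comp measurable_prodMk_left

/-- canonical thinning -/
def Tc (q : ℝ) (hq : q ∈ Set.Ioo (0 : ℝ) 1) (D : ℕ → Measure X → Measure X) (μ : Measure X) :
    Measure (Measure X) := (coins q hq).map (fun ω => Gt D μ ω)

/-- canonical complementary thinning -/
def Tc2 (q : ℝ) (hq : q ∈ Set.Ioo (0 : ℝ) 1) (D : ℕ → Measure X → Measure X) (μ : Measure X) :
    Measure (Measure X) := (coins q hq).map (fun ω => Gf D μ ω)

section
variable {D : ℕ → Measure X → Measure X} (hD : EnumData D) {q : ℝ} (hq : q ∈ Set.Ioo (0 : ℝ) 1)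

include hD

lemma Gt_meas_right (μ : Measure X) : Measurable (fun ω => Gt D μ ω) := 
  comp_left (Gt D) (Gt_measurable hD.meas) μ

lemma Gf_meas_right (μ : Measure X) : Measurable (fun ω => Gf D μ ω) := 
  comp_left (Gf D) (Gf_measurable hD.meas) μ

lemma Tc_measurable : Measurable (Tc q hq D) := by
  refine Measure.measurable_of_measurable_coe _ fun s hs => ?_
  have : ∀ μ, Tc q hq D μ s =
      coins q hq (Prod.mk μ ⁻¹' ((fun p : Measure X × (ℕ → Bool) => Gt D p.1 p.2) ⁻¹' s)) := by
    intro μ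
    rw [Tc, Measure.map_apply (Gt_meas_right hD μ) hs]; rfl
  simp_rw [this]
  exact measurable_measure_prodMk_left (Gt_measurable hD.meas hs)

lemma Tc2_measurable : Measurable (Tc2 q hq D) := by
  refine Measure.measurable_of_measurable_coe _ fun s hs => ?_
  have : ∀ μ, Tc2 q hq D μ s =
      coins q hq (Prod.mk μ ⁻¹' ((fun p : Measure X × (ℕ → Bool) => Gf D p.1 p.2) ⁻¹' s)) := by
    intro μ
    rw [Tc2, Measure.map_apply (Gf_meas_right hD μ) hs]; rfl
  simp_rw [this]
  exact measurable_measure_prodMk_left (Gf_measurable hD.meas hs)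

lemma Tc_prob (μ : Measure X) : IsProbabilityMeasure (Tc q hq D μ) :=
  Measure.isProbabilityMeasure_map (Gt_meas_right hD μ).aemeasurable

lemma Tc2_prob (μ : Measure X) : IsProbabilityMeasure (Tc2 q hq D μ) :=
  Measure.isProbabilityMeasure_map (Gf_meas_right hD μ).aemeasurable

lemma Tc_good [BorelSpace X] (μ : Measure X) (hμ : IsPointMeasure μ) :
    ∀ᵐ ν ∂(Tc q hq D μ), ν ∈ good D μ := by
  refine (ae_map_iff (p := fun ν => ν ∈ good D μ) (Gt_meas_right hD μ).aemeasurable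
    (good_measurable μ)).2 ?_
  exact ae_of_all _ fun ω => Gt_good μ ω (fun j => hD.zo j μ) (hD.sum μ hμ)

lemma Tc2_good [BorelSpace X] (μ : Measure X) (hμ : IsPointMeasure μ) :
    ∀ᵐ ν ∂(Tc2 q hq D μ), ν ∈ good D μ := by
  refine (ae_map_iff (p := fun ν => ν ∈ good D μ) (Gf_meas_right hD μ).aemeasurable
    (good_measurable μ)).2 ?_
  exact ae_of_all _ fun ω => Gf_good μ ω (fun j => hD.zo j μ) (hD.sum μ hμ)

lemma Tc_isThinning [BorelSpace X] (μ : Measure X) (hμ : IsPointMeasure μ) :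
    IsThinning q μ (Tc q hq D μ) := by
  refine ⟨Tc_prob hD hq μ, ?_, fun f hf => ?_⟩
  · filter_upwards [Tc_good hD hq μ hμ] with ν hν
    exact ⟨good_pm μ hμ (fun j => hD.zo j μ) (hD.sum μ hμ) hν,
      good_le μ (fun j => hD.zo j μ) (hD.sum μ hμ) hν⟩
  · have := coins_laplace q hq μ (fun j => hD.zo j μ) (hD.sum μ hμ) hf MemU.zero
    rw [laplaceT, Tc, lintegral_map (eP_measurable hf)
      (Gt_meas_right hD μ)]
    simp only [pairing_zero, expNeg_zero, mul_one] at this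
    rw [this]
    unfold pairing mixLog
    simp only [Pi.zero_apply, neg_zero, Real.exp_zero, mul_one, add_comm]

lemma Tc2_isThinning [BorelSpace X] (μ : Measure X) (hμ : IsPointMeasure μ) :
    IsThinning (1 - q) μ (Tc2 q hq D μ) := by
  refine ⟨Tc2_prob hD hq μ, ?_, fun f hf => ?_⟩
  · filter_upwards [Tc2_good hD hq μ hμ] with ν hν
    exact ⟨good_pm μ hμ (fun j => hD.zo j μ) (hD.sum μ hμ) hν,
      good_le μ (fun j => hD.zo j μ) (hD.sum μ hμ) hν⟩
  · have := coins_laplace q hq μ (fun j => hD.zo j μ) (hD.sum μ hμ) MemU.zero hf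
    rw [laplaceT, Tc2, lintegral_map (eP_measurable hf)
      (Gf_meas_right hD μ)]
    simp only [pairing_zero, expNeg_zero, one_mul] at this
    rw [this]
    unfold pairing mixLog
    have e : 1 - (1 - q) = q := by ring
    simp only [Pi.zero_apply, neg_zero, Real.exp_zero, mul_one, e]

omit hD in
lemma thinning_unique [OpensMeasurableSpace X] {q : ℝ} {μ : Measure X} {T T' : Measure (Measure X)}
    (h : IsThinning q μ T) (h' : IsThinning q μ T') : T = T' := by
  have := h.1; have := h'.1
  exact laplace_unique T T' fun f hf => (h.2.2 f hf).trans (h'.2.2 f hf).symm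

lemma split_lintegral [PolishSpace X] [BorelSpace X] (μ : Measure X) (hμ : IsPointMeasure μ)
    {h : Measure X × Measure X → ℝ≥0∞} (hh : Measurable h) :
    ∫⁻ ν, h (ν, μ - ν) ∂(Tc q hq D μ) = ∫⁻ ω, h (Gt D μ ω, Gf D μ ω) ∂(coins q hq) := by
  have hs := hD.sum μ hμ
  have e1 : ∫⁻ ν, h (ν, μ - ν) ∂(Tc q hq D μ) = ∫⁻ ν, h (ν, rest D μ ν) ∂(Tc q hq D μ) := by
    refine lintegral_congr_ae ?_
    filter_upwards [Tc_good hD hq μ hμ] with ν hν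
    rw [rest_eq μ hμ (fun j => hD.zo j μ) hs hν]
  have hm : Measurable fun ν => h (ν, rest D μ ν) :=
    hh.comp (measurable_id.prodMk (rest_measurable μ))
  rw [e1, Tc, lintegral_map hm (Gt_meas_right hD μ)]
  refine lintegral_congr fun ω => ?_
  rw [← rest_eq μ hμ (fun j => hD.zo j μ) hs (Gt_good μ ω (fun j => hD.zo j μ) hs)]
  have hlf := le_locFin (Gt_le μ ω hs) hμ.2
  have : μ - Gt D μ ω = Gf D μ ω := by
    conv_lhs => enter [1]; rw [← Gt_add_Gf μ ω hs]
    exact add_sub_sfin _ _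
  rw [this]

end

lemma MemU.mixLog {q : ℝ} (hq : q ∈ Set.Ioo (0 : ℝ) 1) {f g : X → ℝ} (hf : MemU f) (hg : MemU g) :
    MemU (mixLog q f g) := by
  have hq0 := hq.1
  have hq1 : 0 < 1 - q := by linarith [hq.2]
  obtain ⟨mf, f0, ⟨C, hC⟩, bf⟩ := hf
  obtain ⟨mg, g0, ⟨C', hC'⟩, bg⟩ := hg
  have e4 : ∀ x, 0 < q * Real.exp (-f x) + (1 - q) * Real.exp (-g x) := fun x => by positivity
  refine ⟨by unfold PoissonSplitting.mixLog; fun_prop, fun x => ?_, ⟨max C C', fun x => ?_⟩,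
    (bf.union bg).subset fun x hx => ?_⟩
  · have e2 : Real.exp (-f x) ≤ 1 := Real.exp_le_one_iff.2 (by linarith [f0 x])
    have e3 : Real.exp (-g x) ≤ 1 := Real.exp_le_one_iff.2 (by linarith [g0 x])
    have : Real.log (q * Real.exp (-f x) + (1 - q) * Real.exp (-g x)) ≤ 0 :=
      Real.log_nonpos (e4 x).le (by nlinarith)
    unfold PoissonSplitting.mixLog; linarith
  · unfold PoissonSplitting.mixLog
    have h1 : Real.exp (-max C C') ≤ Real.exp (-f x) :=
      Real.exp_le_exp.2 (neg_le_neg ((hC x).trans (le_max_left _ _)))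
    have h2 : Real.exp (-max C C') ≤ Real.exp (-g x) :=
      Real.exp_le_exp.2 (neg_le_neg ((hC' x).trans (le_max_right _ _)))
    have : -max C C' ≤ Real.log (q * Real.exp (-f x) + (1 - q) * Real.exp (-g x)) := by
      rw [Real.le_log_iff_exp_le (e4 x)]
      nlinarith
    linarith
  · by_contra hc
    simp only [Set.mem_union, Function.mem_support, not_or, not_not] at hc
    apply hx
    simp [PoissonSplitting.mixLog, hc.1, hc.2]

section Law
variable {D : ℕ → Measure X → Measure X} (hD : EnumData D) {q : ℝ} (hq : q ∈ Set.Ioo (0 : ℝ) 1)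
  (P : Measure (Measure X)) (hP : IsPointProcess P)

/-- canonical splitting law -/
def Sc (D : ℕ → Measure X → Measure X) (q : ℝ) (hq : q ∈ Set.Ioo (0 : ℝ) 1)
    (P : Measure (Measure X)) : Measure (Measure X × Measure X) :=
  (P.prod (coins q hq)).map (fun p => (Gt D p.1 p.2, Gf D p.1 p.2))

include hD hP

lemma Sc_lintegral {h : Measure X × Measure X → ℝ≥0∞} (hh : Measurable h) :
    ∫⁻ p, h p ∂(Sc D q hq P) = ∫⁻ μ, ∫⁻ ω, h (Gt D μ ω, Gf D μ ω) ∂(coins q hq) ∂P := by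
  have := hP.1
  have hm : Measurable (fun p : Measure X × (ℕ → Bool) => (Gt D p.1 p.2, Gf D p.1 p.2)) :=
    (Gt_measurable hD.meas).prodMk (Gf_measurable hD.meas)
  have hm2 : Measurable (fun p : Measure X × (ℕ → Bool) => h (Gt D p.1 p.2, Gf D p.1 p.2)) :=
    hh.comp hm
  rw [Sc, lintegral_map hh hm, lintegral_prod _ hm2.aemeasurable]

lemma split_eq_Sc [PolishSpace X] [BorelSpace X] {T : Measure X → Measure (Measure X)}
    (hT : ∀ μ, IsPointMeasure μ → IsThinning q μ (T μ))
    {h : Measure X × Measure X → ℝ≥0∞} (hh : Measurable h) :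
    ∫⁻ μ, ∫⁻ ν, h (ν, μ - ν) ∂(T μ) ∂P = ∫⁻ p, h p ∂(Sc D q hq P) := by
  rw [Sc_lintegral hD hq P hP hh]
  refine lintegral_congr_ae ?_
  filter_upwards [hP.2] with μ hμ
  rw [thinning_unique (hT μ hμ) (Tc_isThinning hD hq μ hμ), split_lintegral hD hq μ hμ hh]

lemma Sc_laplace {f g : X → ℝ} (hf : MemU f) (hg : MemU g) :
    ∫⁻ p, expNeg (pairing f p.1) * expNeg (pairing g p.2) ∂(Sc D q hq P) =
      laplaceT P (mixLog q f g) := by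
  rw [Sc_lintegral hD hq P hP]
  · refine lintegral_congr_ae ?_
    filter_upwards [hP.2] with μ hμ
    exact coins_laplace q hq μ (fun j => hD.zo j μ) (hD.sum μ hμ) hf hg
  · exact ((eP_measurable hf).comp measurable_fst).mul
      ((eP_measurable hg).comp measurable_snd)

omit hD in
lemma bind_laplace {q : ℝ} {T : Measure X → Measure (Measure X)} (hTm : Measurable T)
    (hT : ∀ μ, IsPointMeasure μ → IsThinning q μ (T μ)) {f : X → ℝ} (hf : MemU f) :
    laplaceT (P.bind T) f = laplaceT P (fun x => -Real.log (1 - q + q * Real.exp (-f x))) := by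
  rw [laplaceT, Measure.lintegral_bind hTm.aemeasurable
    (eP_measurable hf).aemeasurable, laplaceT]
  refine lintegral_congr_ae ?_
  filter_upwards [hP.2] with μ hμ
  exact (hT μ hμ).2.2 f hf

omit hD in
lemma bind_prob {q : ℝ} {T : Measure X → Measure (Measure X)} (hTm : Measurable T)
    (hT : ∀ μ, IsPointMeasure μ → IsThinning q μ (T μ)) : IsProbabilityMeasure (P.bind T) := by
  have := hP.1
  refine ⟨?_⟩
  rw [Measure.bind_apply MeasurableSet.univ hTm.aemeasurable]
  rw [lintegral_congr_ae (g := fun _ => 1)]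
  · simp
  · filter_upwards [hP.2] with μ hμ
    exact (hT μ hμ).1.measure_univ

omit hD hP in
lemma prod_laplace (Q Q' : Measure (Measure X)) [IsProbabilityMeasure Q] [IsProbabilityMeasure Q']
    {f g : X → ℝ} (hf : MemU f) (hg : MemU g) :
    ∫⁻ p, expNeg (pairing f p.1) * expNeg (pairing g p.2) ∂(Q.prod Q') =
      laplaceT Q f * laplaceT Q' g :=
  lintegral_prod_mul (eP_measurable hf).aemeasurable
    (eP_measurable hg).aemeasurable

omit hD in
/-- Forward direction. -/
lemma forward [PolishSpace X] [BorelSpace X] {ϱ : Measure X} (hϱ : IsPoissonPP ϱ P) :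
    ∃ q ∈ Set.Ioo (0 : ℝ) 1,
        ∃ (T T' : Measure X → Measure (Measure X)) (S : Measure (Measure X × Measure X)),
          Measurable T ∧ Measurable T' ∧
          (∀ μ, IsPointMeasure μ → IsThinning q μ (T μ)) ∧
          (∀ μ, IsPointMeasure μ → IsThinning (1 - q) μ (T' μ)) ∧
          (∀ h : Measure X × Measure X → ℝ≥0∞, Measurable h →
            ∫⁻ p, h p ∂S = ∫⁻ μ, ∫⁻ ν, h (ν, μ - ν) ∂(T μ) ∂P) ∧
          S = (P.bind T).prod (P.bind T') := by
  obtain ⟨D, hD⟩ := exists_enumData (X := X)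
  have hq : (1 / 2 : ℝ) ∈ Set.Ioo (0 : ℝ) 1 := by constructor <;> norm_num
  generalize (1 / 2 : ℝ) = q at hq
  have hT := Tc_isThinning hD hq
  have hT2 := Tc2_isThinning hD hq
  have hm := Tc_measurable hD hq
  have hm2 := Tc2_measurable hD hq
  refine ⟨q, hq, Tc q hq D, Tc2 q hq D, _, hm, hm2, hT, hT2, ?_, rfl⟩
  intro h hh
  rw [split_eq_Sc hD hq P hP hT hh]
  congr 1
  have hq0 := hq.1
  have hq1 : 0 < 1 - q := by linarith [hq.2]
  have i1 := bind_prob P hP hm hT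
  have i2 := bind_prob P hP hm2 hT2
  have i0 := hP.1
  have i3 : IsFiniteMeasure (Sc D q hq P) := by unfold Sc; infer_instance
  refine laplace_unique_pair _ _ fun f g hf hg => ?_
  rw [prod_laplace _ _ hf hg, Sc_laplace hD hq P hP hf hg, bind_laplace P hP hm hT hf,
    bind_laplace P hP hm2 hT2 hg]
  have a1 : (fun x => -Real.log (1 - q + q * Real.exp (-f x))) = mixLog q f 0 := by
    funext x; simp [mixLog, add_comm]
  have a2 : (fun x => -Real.log (1 - (1 - q) + (1 - q) * Real.exp (-g x))) = mixLog q 0 g := by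
    funext x; simp [mixLog]
  rw [a1, a2, hϱ.2.2 _ (MemU.mixLog hq hf MemU.zero), hϱ.2.2 _ (MemU.mixLog hq MemU.zero hg),
    hϱ.2.2 _ (MemU.mixLog hq hf hg), ← expNeg_add]
  have hexp : ∀ (f g : X → ℝ) x, Real.exp (-mixLog q f g x) =
      q * Real.exp (-f x) + (1 - q) * Real.exp (-g x) := by
    intro f g x
    rw [mixLog, neg_neg, Real.exp_log (by positivity)]
  have mf := hf.1
  have mg := hg.1
  rw [← lintegral_add_left]
  · congr 1
    refine lintegral_congr fun x => ?_
    have e2 : Real.exp (-f x) ≤ 1 := Real.exp_le_one_iff.2 (by linarith [hf.2.1 x])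
    have e3 : Real.exp (-g x) ≤ 1 := Real.exp_le_one_iff.2 (by linarith [hg.2.1 x])
    simp only [hexp, Pi.zero_apply, neg_zero, Real.exp_zero]
    rw [← ENNReal.ofReal_add]
    · congr 1; ring
    · nlinarith
    · nlinarith
  · exact ((measurable_const.sub (MemU.mixLog hq hf MemU.zero).1.neg.exp)).ennreal_ofReal

omit hD in
/-- the functional equation -/
lemma func_eq [PolishSpace X] [BorelSpace X] (hq : q ∈ Set.Ioo (0 : ℝ) 1)
    {T T' : Measure X → Measure (Measure X)} {S : Measure (Measure X × Measure X)}
    (hm : Measurable T) (hm2 : Measurable T')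
    (hT : ∀ μ, IsPointMeasure μ → IsThinning q μ (T μ))
    (hT2 : ∀ μ, IsPointMeasure μ → IsThinning (1 - q) μ (T' μ))
    (hS : ∀ h : Measure X × Measure X → ℝ≥0∞, Measurable h →
              ∫⁻ p, h p ∂S = ∫⁻ μ, ∫⁻ ν, h (ν, μ - ν) ∂(T μ) ∂P)
    (hSS : S = (P.bind T).prod (P.bind T')) {f : X → ℝ} (hf : MemU f) :
    laplaceT P f = laplaceT P (fun x => -Real.log (1 - q + q * Real.exp (-f x))) *
      laplaceT P (fun x => -Real.log (1 - (1 - q) + (1 - q) * Real.exp (-f x))) := by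
  obtain ⟨D, hD⟩ := exists_enumData (X := X)
  have i1 := bind_prob P hP hm hT
  have i2 := bind_prob P hP hm2 hT2
  have hmeas : Measurable fun p : Measure X × Measure X =>
      expNeg (pairing f p.1) * expNeg (pairing f p.2) :=
    ((eP_measurable hf).comp measurable_fst).mul
      ((eP_measurable hf).comp measurable_snd)
  rw [← bind_laplace P hP hm hT hf, ← bind_laplace P hP hm2 hT2 hf, ← prod_laplace _ _ hf hf,
    ← hSS, hS _ hmeas, split_eq_Sc hD hq P hP hT hmeas, Sc_laplace hD hq P hP hf hf]
  congr 1
  funext x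
  simp [mixLog, ← add_mul]

end Law

end PoissonSplitting

namespace PoissonSplitting

open Filter Topology

lemma exp_slope (a : ℝ) : Tendsto (fun s : ℝ => (1 - Real.exp (-(a * s))) / s) (𝓝[>] 0) (𝓝 a) := by
  have h : HasDerivAt (fun s : ℝ => 1 - Real.exp (-(a * s))) a 0 := by
    have h1 : HasDerivAt (fun s : ℝ => -(a * s)) (-(a * 1)) 0 := ((hasDerivAt_id 0).const_mul a).neg
    have h2 := (h1.exp).const_sub 1
    simpa using h2
  have h3 := (hasDerivAt_iff_tendsto_slope.1 h).mono_left
    (nhdsWithin_mono 0 (fun x (hx : 0 < x) => hx.ne'))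
  refine h3.congr fun s => ?_
  simp [slope_def_field]

lemma prop_ind {q : ℝ} (hq : q ∈ Set.Ioo (0 : ℝ) 1) (C : ℝ → Prop)
    (hstep : ∀ s, 0 ≤ s → s ≤ 1 → C (q * s) → C ((1 - q) * s) → C s)
    {r : ℝ} (hr : 0 < r) (hbase : ∀ s, 0 ≤ s → s < r → C s) : C 1 := by
  have hq0 := hq.1
  have hq1 := hq.2
  set m := max q (1 - q) with hm
  have hm1 : m < 1 := max_lt hq.2 (by linarith)
  have hm0 : 0 < m := lt_max_of_lt_left hq.1
  have key : ∀ n : ℕ, ∀ s, 0 ≤ s → s ≤ 1 → s * m ^ n < r → C s := by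
    intro n
    induction n with
    | zero => intro s h0 _ h; exact hbase s h0 (by simpa using h)
    | succ n ih =>
      intro s h0 h1 h
      have hp : 0 < m ^ n := pow_pos hm0 n
      have e : ∀ t, 0 ≤ t → t ≤ m → t * s * m ^ n < r := by
        intro t ht0 ht
        refine lt_of_le_of_lt ?_ h
        rw [pow_succ]
        have : t * (s * m ^ n) ≤ m * (s * m ^ n) := mul_le_mul_of_nonneg_right ht (by positivity)
        linarith
      refine hstep s h0 h1 (ih _ (by positivity) (by nlinarith) (e q hq0.le (le_max_left _ _)))
        (ih _ (mul_nonneg (by linarith) h0) (by nlinarith) (e (1 - q) (by linarith) (le_max_right _ _)))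
  obtain ⟨n, hn⟩ := exists_pow_lt_of_lt_one hr hm1
  exact key n 1 zero_le_one le_rfl (by simpa using hn)

lemma real_core {q : ℝ} (hq : q ∈ Set.Ioo (0 : ℝ) 1) (φ : ℝ → ℝ) (h0 : ∀ s, 0 ≤ φ s)
    (hz : φ 0 = 1) (hfe : ∀ s, 0 ≤ s → s ≤ 1 → φ s = φ (q * s) * φ ((1 - q) * s)) {l : ℝ}
    (hl : Tendsto (fun s => (1 - φ s) / s) (𝓝[>] 0) (𝓝 l)) : φ 1 = Real.exp (-l) := by
  have split : ∀ a s : ℝ, Real.exp (-(a * s)) =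
      Real.exp (-(a * (q * s))) * Real.exp (-(a * ((1 - q) * s))) := by
    intro a s; rw [← Real.exp_add]; congr 1; ring
  have lower : ∀ a, l < a → Real.exp (-a) ≤ φ 1 := by
    intro a ha
    have ev := hl.eventually_lt (exp_slope a) ha
    obtain ⟨r, hr, hrr⟩ := mem_nhdsGT_iff_exists_Ioo_subset.1 ev
    have := prop_ind hq (fun s => Real.exp (-(a * s)) ≤ φ s) ?_ (r := r) hr ?_
    · simpa using this
    · intro s hs0 hs1 h1 h2
      rw [hfe s hs0 hs1, split]
      exact mul_le_mul h1 h2 (Real.exp_pos _).le (h0 _)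
    · intro s hs0 hsr
      rcases hs0.eq_or_lt with rfl | hs
      · simp [hz]
      · have h := hrr ⟨hs, hsr⟩
        have h' : (1 - φ s) / s < (1 - Real.exp (-(a * s))) / s := h
        rw [div_lt_div_iff_of_pos_right hs] at h'
        linarith
  have upper : ∀ a, a < l → φ 1 ≤ Real.exp (-a) := by
    intro a ha
    have ev := (exp_slope a).eventually_lt hl ha
    obtain ⟨r, hr, hrr⟩ := mem_nhdsGT_iff_exists_Ioo_subset.1 ev
    have := prop_ind hq (fun s => φ s ≤ Real.exp (-(a * s))) ?_ (r := r) hr ?_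
    · simpa using this
    · intro s hs0 hs1 h1 h2
      rw [hfe s hs0 hs1, split]
      exact mul_le_mul h1 h2 (h0 _) (Real.exp_pos _).le
    · intro s hs0 hsr
      rcases hs0.eq_or_lt with rfl | hs
      · simp [hz]
      · have h := hrr ⟨hs, hsr⟩
        have h' : (1 - Real.exp (-(a * s))) / s < (1 - φ s) / s := h
        rw [div_lt_div_iff_of_pos_right hs] at h'
        linarith
  have cont : Continuous fun a : ℝ => Real.exp (-a) := by fun_prop
  refine le_antisymm ?_ ?_
  · refine ge_of_tendsto (cont.continuousWithinAt (s := Set.Iio l) (x := l)) ?_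
    filter_upwards [self_mem_nhdsWithin] with a ha using upper a ha
  · refine le_of_tendsto (cont.continuousWithinAt (s := Set.Ioi l) (x := l)) ?_
    filter_upwards [self_mem_nhdsWithin] with a ha using lower a ha

variable {X : Type*} [MeasurableSpace X] [MetricSpace X]

/-- interpolation -/
def Fs (f : X → ℝ) (s : ℝ) (x : X) : ℝ := -Real.log (1 - s + s * Real.exp (-f x))

lemma Fs_zero (f : X → ℝ) : Fs f 0 = 0 := by funext x; simp [Fs]
lemma Fs_one (f : X → ℝ) : Fs f 1 = f := by funext x; simp [Fs]

lemma Fs_memU {f : X → ℝ} (hf : MemU f) {s : ℝ} (h0 : 0 ≤ s) (h1 : s ≤ 1) : MemU (Fs f s) := by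
  rcases h0.eq_or_lt with rfl | h0
  · rw [Fs_zero]; exact MemU.zero
  rcases h1.eq_or_lt with rfl | h1
  · rw [Fs_one]; exact hf
  have : Fs f s = mixLog s f 0 := by funext x; simp [Fs, mixLog, add_comm]
  rw [this]; exact MemU.mixLog ⟨h0, h1⟩ hf MemU.zero

lemma Fs_pos {f : X → ℝ} {s : ℝ} (h0 : 0 ≤ s) (h1 : s ≤ 1) (x : X) :
    0 < 1 - s + s * Real.exp (-f x) := by
  have := Real.exp_pos (-f x)
  rcases h0.eq_or_lt with rfl | h0
  · norm_num
  · have : 0 < s * Real.exp (-f x) := by positivity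
    linarith

lemma Fs_comp {f : X → ℝ} {s : ℝ} (h0 : 0 ≤ s) (h1 : s ≤ 1) (t : ℝ) :
    (fun x => -Real.log (1 - t + t * Real.exp (-Fs f s x))) = Fs f (t * s) := by
  funext x
  rw [Fs, Fs, neg_neg, Real.exp_log (Fs_pos h0 h1 x)]
  congr 2; ring

lemma Fs_bounds {f : X → ℝ} (hf : MemU f) {s : ℝ} (h0 : 0 < s) (h1 : s < 1) (x : X) :
    s * (1 - Real.exp (-f x)) ≤ Fs f s x ∧ Fs f s x ≤ s / (1 - s) * (1 - Real.exp (-f x)) := by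
  have e1 : Real.exp (-f x) ≤ 1 := Real.exp_le_one_iff.2 (by linarith [hf.2.1 x])
  have e2 := Real.exp_pos (-f x)
  have hp := Fs_pos (f := f) h0.le h1.le x
  set u := 1 - s + s * Real.exp (-f x) with hu
  constructor
  · have := Real.log_le_sub_one_of_pos hp
    rw [Fs]; rw [← hu]; nlinarith
  · have := Real.one_sub_inv_le_log_of_pos hp
    rw [Fs]; rw [← hu]
    have h2 : u⁻¹ - 1 = s * (1 - Real.exp (-f x)) / u := by
      field_simp; rw [hu]; ring
    have h3 : s * (1 - Real.exp (-f x)) / u ≤ s * (1 - Real.exp (-f x)) / (1 - s) := by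
      apply div_le_div_of_nonneg_left
      · exact mul_nonneg h0.le (by linarith)
      · linarith
      · rw [hu]; nlinarith
    have h4 : s / (1 - s) * (1 - Real.exp (-f x)) = s * (1 - Real.exp (-f x)) / (1 - s) := by ring
    linarith

/-- one minus exponential -/
def omE (f : X → ℝ) (x : X) : ℝ := 1 - Real.exp (-f x)

lemma omE_memU {f : X → ℝ} (hf : MemU f) : MemU (omE f) := by
  obtain ⟨m, h0, -, b⟩ := hf
  refine ⟨by unfold omE; fun_prop, fun x => ?_, ⟨1, fun x => ?_⟩, b.subset fun x hx => ?_⟩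
  · have e1 : Real.exp (-f x) ≤ 1 := Real.exp_le_one_iff.2 (by linarith [h0 x])
    unfold omE; linarith
  · have := Real.exp_pos (-f x)
    unfold omE; linarith
  · intro hc; apply hx; simp [omE, hc]

lemma pairing_smul (c : ℝ) (hc : 0 ≤ c) (f : X → ℝ) (μ : Measure X) (hf : MemU f) :
    pairing (fun x => c * f x) μ = ENNReal.ofReal c * pairing f μ := by
  unfold pairing
  simp_rw [ENNReal.ofReal_mul hc]
  exact lintegral_const_mul _ hf.1.ennreal_ofReal

lemma pairing_mono {f g : X → ℝ} (h : ∀ x, f x ≤ g x) (μ : Measure X) :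
    pairing f μ ≤ pairing g μ := lintegral_mono fun x => ENNReal.ofReal_le_ofReal (h x)

lemma expNeg_toReal {a : ℝ≥0∞} (h : a ≠ ∞) : (expNeg a).toReal = Real.exp (-a.toReal) := by
  rw [expNeg, if_neg h, ENNReal.toReal_ofReal (Real.exp_pos _).le]

lemma laplace_toReal (P : Measure (Measure X)) {f : X → ℝ} (hf : MemU f) :
    (laplaceT P f).toReal = ∫ μ, (expNeg (pairing f μ)).toReal ∂P := by
  rw [integral_toReal (eP_measurable hf).aemeasurable, laplaceT]
  exact ae_of_all _ fun μ => (expNeg_le_one _).trans_lt ENNReal.one_lt_top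

lemma eP_integrable (P : Measure (Measure X)) [IsProbabilityMeasure P] {f : X → ℝ} (hf : MemU f) :
    Integrable (fun μ => (expNeg (pairing f μ)).toReal) P := by
  refine Integrable.of_bound (C := 1) (eP_measurable hf).ennreal_toReal.aestronglyMeasurable
    (ae_of_all _ fun μ => ?_)
  rw [Real.norm_of_nonneg ENNReal.toReal_nonneg]
  exact ENNReal.toReal_le_of_le_ofReal zero_le_one (by simpa using expNeg_le_one _)

lemma pointwise_slope {f : X → ℝ} (hf : MemU f) {μ : Measure X} (hμ : pairing (omE f) μ ≠ ∞)
    {s : ℝ} (h0 : 0 < s) (h1 : s < 1) :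
    (1 - Real.exp (-((pairing (omE f) μ).toReal * s))) / s ≤
        (1 - (expNeg (pairing (Fs f s) μ)).toReal) / s ∧
      (1 - (expNeg (pairing (Fs f s) μ)).toReal) / s ≤ (pairing (omE f) μ).toReal / (1 - s) := by
  have hU := omE_memU hf
  have hs : 0 ≤ s / (1 - s) := div_nonneg h0.le (by linarith)
  have a1 : ENNReal.ofReal s * pairing (omE f) μ ≤ pairing (Fs f s) μ := by
    rw [← pairing_smul s h0.le _ _ hU]
    exact pairing_mono (fun x => (Fs_bounds hf h0 h1 x).1) μ
  have a2 : pairing (Fs f s) μ ≤ ENNReal.ofReal (s / (1 - s)) * pairing (omE f) μ := by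
    rw [← pairing_smul _ hs _ _ hU]
    exact pairing_mono (fun x => (Fs_bounds hf h0 h1 x).2) μ
  have fin2 : ENNReal.ofReal (s / (1 - s)) * pairing (omE f) μ ≠ ∞ :=
    ENNReal.mul_ne_top ENNReal.ofReal_ne_top hμ
  have fin1 : pairing (Fs f s) μ ≠ ∞ := ne_top_of_le_ne_top fin2 a2
  have b1 := ENNReal.toReal_mono fin1 a1
  have b2 := ENNReal.toReal_mono fin2 a2
  rw [ENNReal.toReal_mul, ENNReal.toReal_ofReal h0.le] at b1
  rw [ENNReal.toReal_mul, ENNReal.toReal_ofReal hs] at b2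
  rw [expNeg_toReal fin1]
  constructor
  · rw [div_le_div_iff_of_pos_right h0]
    have : Real.exp (-(pairing (Fs f s) μ).toReal) ≤
        Real.exp (-((pairing (omE f) μ).toReal * s)) := Real.exp_le_exp.2 (by linarith)
    linarith
  · rw [div_le_iff₀ h0]
    have := Real.add_one_le_exp (-(pairing (Fs f s) μ).toReal)
    have e : (pairing (omE f) μ).toReal / (1 - s) * s =
      s / (1 - s) * (pairing (omE f) μ).toReal := by ring
    linarith

lemma moment_pairing (P : Measure (Measure X)) {f : X → ℝ} (hf : MemU f) :
    pairing f (momentMeasure P) = ∫⁻ μ, pairing f μ ∂P := by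
  unfold pairing momentMeasure
  rw [Measure.lintegral_bind measurable_id.aemeasurable hf.1.ennreal_ofReal.aemeasurable]
  rfl

lemma slope_tendsto (P : Measure (Measure X)) [IsProbabilityMeasure P] {f : X → ℝ} (hf : MemU f)
    (hfin : pairing (omE f) (momentMeasure P) ≠ ∞) :
    Tendsto (fun s => (1 - (laplaceT P (Fs f s)).toReal) / s) (𝓝[>] 0)
      (𝓝 (pairing (omE f) (momentMeasure P)).toReal) := by
  have hU := omE_memU hf
  rw [moment_pairing P hU] at hfin ⊢
  have hae : ∀ᵐ μ ∂P, pairing (omE f) μ < ∞ :=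
    ae_lt_top (pairing_measurable hU) hfin
  rw [← integral_toReal (pairing_measurable hU).aemeasurable hae]
  have hs : ∀ᶠ s : ℝ in 𝓝[>] 0, 0 < s ∧ s < 1 / 2 :=
    Ioo_mem_nhdsGT (by norm_num : (0 : ℝ) < 1 / 2)
  have main : Tendsto (fun s => ∫ μ, (1 - (expNeg (pairing (Fs f s) μ)).toReal) / s ∂P) (𝓝[>] 0)
      (𝓝 (∫ μ, (pairing (omE f) μ).toReal ∂P)) := by
    refine tendsto_integral_filter_of_dominated_convergence
      (fun μ => 2 * (pairing (omE f) μ).toReal) ?_ ?_ ?_ ?_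
    · filter_upwards [hs] with s hs
      exact ((measurable_const.sub (eP_measurable
        (Fs_memU hf hs.1.le (by linarith [hs.2]))).ennreal_toReal).div_const s).aestronglyMeasurable
    · filter_upwards [hs] with s hs
      filter_upwards [hae] with μ hμ
      have h := (pointwise_slope hf hμ.ne hs.1 (by linarith [hs.2])).2
      have hz : 0 ≤ (pairing (omE f) μ).toReal := ENNReal.toReal_nonneg
      rw [Real.norm_of_nonneg]
      · refine h.trans ?_
        rw [div_le_iff₀ (by linarith [hs.2])]
        nlinarith [hs.2]
      · refine div_nonneg (sub_nonneg.2 ?_) hs.1.le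
        exact ENNReal.toReal_le_of_le_ofReal zero_le_one (by simpa using expNeg_le_one _)
    · exact (integrable_toReal_of_lintegral_ne_top (pairing_measurable hU).aemeasurable hfin).const_mul 2
    · filter_upwards [hae] with μ hμ
      have t2 : Tendsto (fun s : ℝ => (pairing (omE f) μ).toReal / (1 - s)) (𝓝[>] 0)
          (𝓝 (pairing (omE f) μ).toReal) := by
        have : ContinuousAt (fun s : ℝ => (pairing (omE f) μ).toReal / (1 - s)) 0 :=
          continuousAt_const.div (by fun_prop) (by norm_num)
        have h := this.tendsto
        simp only [sub_zero, div_one] at h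
        exact h.mono_left nhdsWithin_le_nhds
      refine tendsto_of_tendsto_of_tendsto_of_le_of_le' (exp_slope _) t2 ?_ ?_
      · filter_upwards [hs] with s hs
        exact (pointwise_slope hf hμ.ne hs.1 (by linarith [hs.2])).1
      · filter_upwards [hs] with s hs
        exact (pointwise_slope hf hμ.ne hs.1 (by linarith [hs.2])).2
  refine main.congr' ?_
  filter_upwards [hs] with s hs
  have hm := Fs_memU hf hs.1.le (by linarith [hs.2])
  rw [integral_div, integral_sub (integrable_const _) (eP_integrable P hm), laplace_toReal P hm]
  simp

lemma backward_fin (P : Measure (Measure X)) [IsProbabilityMeasure P] {q : ℝ}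
    (hq : q ∈ Set.Ioo (0 : ℝ) 1)
    (hfe : ∀ f, MemU f → laplaceT P f = laplaceT P (fun x => -Real.log (1 - q + q * Real.exp (-f x))) *
      laplaceT P (fun x => -Real.log (1 - (1 - q) + (1 - q) * Real.exp (-f x))))
    {f : X → ℝ} (hf : MemU f) (hfin : pairing (omE f) (momentMeasure P) ≠ ∞) :
    laplaceT P f = expNeg (pairing (omE f) (momentMeasure P)) := by
  have hz : (laplaceT P (Fs f 0)).toReal = 1 := by
    rw [Fs_zero]; simp [laplaceT, pairing_zero, expNeg_zero]
  have h := real_core hq (fun s => (laplaceT P (Fs f s)).toReal) (fun s => ENNReal.toReal_nonneg) hz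
    ?_ (slope_tendsto P hf hfin)
  · beta_reduce at h
    rw [Fs_one] at h
    have hlt : laplaceT P f ≠ ∞ := by
      have : laplaceT P f ≤ ∫⁻ _, 1 ∂P := lintegral_mono fun μ => expNeg_le_one _
      exact ne_top_of_le_ne_top (by simp) this
    rw [expNeg, if_neg hfin, ← h, ENNReal.ofReal_toReal hlt]
  · intro s h0 h1
    beta_reduce
    rw [hfe _ (Fs_memU hf h0 h1), Fs_comp h0 h1, Fs_comp h0 h1, ENNReal.toReal_mul]

lemma pairing_indicator_tendsto {K : ℕ → Set X} (hK : Monotone K) (hU : ⋃ n, K n = Set.univ)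
    (hm : ∀ n, MeasurableSet (K n)) {f : X → ℝ} (hf : MemU f) (μ : Measure X) :
    Tendsto (fun n => pairing ((K n).indicator f) μ) atTop (𝓝 (pairing f μ)) := by
  unfold pairing
  have hf0 := hf.2.1
  refine lintegral_tendsto_of_tendsto_of_monotone
    (fun n => (hf.1.indicator (hm n)).ennreal_ofReal.aemeasurable) ?_ ?_
  · refine ae_of_all _ fun x a b hab => ENNReal.ofReal_le_ofReal ?_
    exact Set.indicator_le_indicator_of_subset (hK hab) hf0 x
  · refine ae_of_all _ fun x => tendsto_const_nhds.congr' ?_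
    obtain ⟨n, hn⟩ := Set.mem_iUnion.1 (hU ▸ Set.mem_univ x : x ∈ ⋃ n, K n)
    filter_upwards [eventually_ge_atTop n] with k hk
    rw [Set.indicator_of_mem (hK hk hn)]

lemma MemU.indicator {K : Set X} (hm : MeasurableSet K) {f : X → ℝ} (hf : MemU f) :
    MemU (K.indicator f) := by
  obtain ⟨m, h0, ⟨C, hC⟩, b⟩ := hf
  refine ⟨m.indicator hm, fun x => Set.indicator_nonneg (fun x _ => h0 x) x, ⟨C, fun x => ?_⟩,
    b.subset ?_⟩
  · exact (Set.indicator_le_self' (fun x _ => h0 x) x).trans (hC x)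
  · intro x hx hc
    apply hx
    by_cases hxK : x ∈ K <;> simp [hxK, hc]

lemma omE_indicator (K : Set X) (f : X → ℝ) : omE (K.indicator f) = K.indicator (omE f) := by
  funext x
  by_cases hx : x ∈ K <;> simp [omE, hx]

lemma backward_all [PolishSpace X] [BorelSpace X] (P : Measure (Measure X)) [IsProbabilityMeasure P]
    (hP1 : IsFirstOrder P) {q : ℝ} (hq : q ∈ Set.Ioo (0 : ℝ) 1)
    (hfe : ∀ f, MemU f → laplaceT P f = laplaceT P (fun x => -Real.log (1 - q + q * Real.exp (-f x))) *
      laplaceT P (fun x => -Real.log (1 - (1 - q) + (1 - q) * Real.exp (-f x))))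
    {f : X → ℝ} (hf : MemU f) :
    laplaceT P f = expNeg (pairing (omE f) (momentMeasure P)) := by
  have : IsLocallyFiniteMeasure (momentMeasure P) := hP1
  have hU := omE_memU hf
  let K := spanningSets (momentMeasure P)
  have hK : Monotone K := monotone_spanningSets _
  have hKU : ⋃ n, K n = Set.univ := iUnion_spanningSets _
  have hKm : ∀ n, MeasurableSet (K n) := measurableSet_spanningSets _
  have hn : ∀ n, laplaceT P ((K n).indicator f) =
      expNeg (pairing ((K n).indicator (omE f)) (momentMeasure P)) := by
    intro n
    rw [← omE_indicator]
    refine backward_fin P hq hfe (hf.indicator (hKm n)) ?_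
    rw [omE_indicator]
    have : pairing ((K n).indicator (omE f)) (momentMeasure P) ≤ momentMeasure P (K n) := by
      rw [← lintegral_indicator_one (hKm n)]
      refine lintegral_mono fun x => ?_
      by_cases hx : x ∈ K n
      · simp [hx, omE, Real.exp_nonneg]
      · simp [hx]
    exact ne_top_of_le_ne_top (measure_spanningSets_lt_top _ n).ne this
  have t1 : Tendsto (fun n => laplaceT P ((K n).indicator f)) atTop (𝓝 (laplaceT P f)) := by
    refine tendsto_lintegral_of_dominated_convergence (fun _ => 1) ?_ ?_ ?_ ?_
    · exact fun n => eP_measurable (hf.indicator (hKm n))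
    · exact fun n => ae_of_all _ fun μ => expNeg_le_one _
    · simp
    · exact ae_of_all _ fun μ => (expNeg_continuous.tendsto _).comp
        (pairing_indicator_tendsto hK hKU hKm hf μ)
  simp_rw [hn] at t1
  exact tendsto_nhds_unique t1 ((expNeg_continuous.tendsto _).comp
        (pairing_indicator_tendsto hK hKU hKm hU _))

lemma backward [PolishSpace X] [BorelSpace X] (P : Measure (Measure X)) (hP : IsPointProcess P)
    (hP1 : IsFirstOrder P) {q : ℝ} (hq : q ∈ Set.Ioo (0 : ℝ) 1)
    {T T' : Measure X → Measure (Measure X)} {S : Measure (Measure X × Measure X)}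
    (hm : Measurable T) (hm2 : Measurable T')
    (hT : ∀ μ, IsPointMeasure μ → IsThinning q μ (T μ))
    (hT2 : ∀ μ, IsPointMeasure μ → IsThinning (1 - q) μ (T' μ))
    (hS : ∀ h : Measure X × Measure X → ℝ≥0∞, Measurable h →
              ∫⁻ p, h p ∂S = ∫⁻ μ, ∫⁻ ν, h (ν, μ - ν) ∂(T μ) ∂P)
    (hSS : S = (P.bind T).prod (P.bind T')) : IsPoissonPP (momentMeasure P) P := by
  have := hP.1
  exact ⟨hP.1, hP.2, fun f hf => backward_all P hP1 hq
    (fun f hf => func_eq P hP hq hm hm2 hT hT2 hS hSS hf) hf⟩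

end PoissonSplitting

open MeasureTheory ENNReal PoissonSplitting

/-- Theorem 1: a point process `P` of first order is a Poisson point process if and only
if for some `q ∈ (0,1)` its splitting law factorizes into its marginals,
`S_q(P) = Γ_q(P) ⊗ Γ_{1-q}(P)`; moreover, in that case `P = Π_{ν_P}`. -/
theorem statement9 {X : Type*} [MeasurableSpace X] [MetricSpace X] [PolishSpace X]
    [BorelSpace X] (P : Measure (Measure X)) (hP : IsPointProcess P)
    (hP1 : IsFirstOrder P) :
    ((∃ ϱ : Measure X, IsLocallyFiniteMeasure ϱ ∧ IsPoissonPP ϱ P) ↔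
      ∃ q ∈ Set.Ioo (0 : ℝ) 1,
        ∃ (T T' : Measure X → Measure (Measure X)) (S : Measure (Measure X × Measure X)),
          Measurable T ∧ Measurable T' ∧
          (∀ μ, IsPointMeasure μ → IsThinning q μ (T μ)) ∧
          (∀ μ, IsPointMeasure μ → IsThinning (1 - q) μ (T' μ)) ∧
          (∀ h : Measure X × Measure X → ℝ≥0∞, Measurable h →
            ∫⁻ p, h p ∂S = ∫⁻ μ, ∫⁻ ν, h (ν, μ - ν) ∂(T μ) ∂P) ∧
          S = (P.bind T).prod (P.bind T'))
      ∧ ∀ q ∈ Set.Ioo (0 : ℝ) 1,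
          ∀ (T T' : Measure X → Measure (Measure X)) (S : Measure (Measure X × Measure X)),
            Measurable T → Measurable T' →
            (∀ μ, IsPointMeasure μ → IsThinning q μ (T μ)) →
            (∀ μ, IsPointMeasure μ → IsThinning (1 - q) μ (T' μ)) →
            (∀ h : Measure X × Measure X → ℝ≥0∞, Measurable h →
              ∫⁻ p, h p ∂S = ∫⁻ μ, ∫⁻ ν, h (ν, μ - ν) ∂(T μ) ∂P) →
            S = (P.bind T).prod (P.bind T') →
            IsPoissonPP (momentMeasure P) P := by
  refine ⟨⟨?_, ?_⟩, ?_⟩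
  · rintro ⟨ϱ, -, hϱ⟩
    exact forward P hP hϱ
  · rintro ⟨q, hq, T, T', S, h1, h2, h3, h4, h5, h6⟩
    exact ⟨momentMeasure P, hP1, backward P hP hP1 hq h1 h2 h3 h4 h5 h6⟩
  · intro q hq T T' S h1 h2 h3 h4 h5 h6
    exact backward P hP hP1 hq h1 h2 h3 h4 h5 h6
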